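/- Let E2 = { [0; a1, a2, …] : a_j ∈ {1,2} for all j ≥ 1 }. Then dim_H((M \ L) ∩ (3.042, √13)) ≤ 0.174813 + dim_H E2 < 0.706094, where M and L are the Markov and Lagrange spectra. -/

import Mathlib

open Filter

/-- Numerators of the convergents of the continued fraction `[a 0; a 1, a 2, …]`. -/
def cfNum (a : ℕ → ℕ) : ℕ → ℕ
  | 0 => a 0
  | 1 => a 1 * a 0 + 1
  | n + 2 => a (n + 2) * cfNum a (n + 1) + cfNum a n

/-- Denominators of the convergents of the continued fraction `[a 0; a 1, a 2, …]`. -/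
def cfDen (a : ℕ → ℕ) : ℕ → ℕ
  | 0 => 1
  | 1 => a 1
  | n + 2 => a (n + 2) * cfDen a (n + 1) + cfDen a n

/-- Value of the infinite continued fraction `[a 0; a 1, a 2, …]` (the limit of its
convergents). -/
noncomputable def cfVal (a : ℕ → ℕ) : ℝ :=
  limUnder atTop fun n => (cfNum a n : ℝ) / (cfDen a n)

/-- Value of the infinite continued fraction `[0; a 0, a 1, …]`. -/
noncomputable def cf01 (a : ℕ → ℕ) : ℝ := 1 / cfVal a

/-- `λ₀(α) = [α 0; α 1, α 2, …] + [0; α (-1), α (-2), …]`. -/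
noncomputable def lambda0 (α : ℤ → ℕ) : ℝ :=
  cfVal (fun n : ℕ => α (n : ℤ)) + cf01 (fun n : ℕ => α (-((n : ℤ) + 1)))

/-- The shift `σ^N` on bi-infinite sequences. -/
def shiftZ (N : ℤ) (α : ℤ → ℕ) : ℤ → ℕ := fun i => α (i + N)

/-- The Markov value `m(α) = sup_{n ∈ ℤ} λ₀(σⁿ α)`. -/
noncomputable def markovValue (α : ℤ → ℕ) : ℝ := ⨆ n : ℤ, lambda0 (shiftZ n α)

/-- The Lagrange value `ℓ(α) = limsup_{n → +∞} λ₀(σⁿ α)`. -/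
noncomputable def lagrangeValue (α : ℤ → ℕ) : ℝ :=
  limsup (fun n : ℕ => lambda0 (shiftZ (n : ℤ) α)) atTop

/-- The Markov spectrum `M`. -/
def MarkovSpectrum : Set ℝ :=
  { x | ∃ α : ℤ → ℕ, (∀ i, 1 ≤ α i) ∧ markovValue α = x }

/-- The Lagrange spectrum `L`. -/
def LagrangeSpectrum : Set ℝ :=
  { x | ∃ α : ℤ → ℕ, (∀ i, 1 ≤ α i) ∧ lagrangeValue α = x }

/-- The finite word `w` occurs in the one-sided sequence `a` starting at position `i`. -/
def occursAtN (a : ℕ → ℕ) (i : ℕ) (w : List ℕ) : Prop :=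
  ∀ j < w.length, a (i + j) = w.getD j 0

/-- The Gauss–Cantor set of reals `[0; a₁, a₂, …]` whose partial quotients all lie in `D`
and whose digit sequence contains no word of `F`, nor the reverse of a word of `F`, as a
consecutive substring. -/
noncomputable def gaussCantorRev (D : Set ℕ) (F : List (List ℕ)) : Set ℝ :=
  { x | ∃ a : ℕ → ℕ, (∀ n, a n ∈ D) ∧
      (∀ w ∈ F, ∀ i, ¬ occursAtN a i w ∧ ¬ occursAtN a i w.reverse) ∧ x = cf01 a }

/-- The Gauss–Cantor set of reals `[0; a₁, a₂, …]` whose partial quotients all lie in `D`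
and whose digit sequence contains no word of `F` as a consecutive substring. -/
noncomputable def gaussCantor (D : Set ℕ) (F : List (List ℕ)) : Set ℝ :=
  { x | ∃ a : ℕ → ℕ, (∀ n, a n ∈ D) ∧ (∀ w ∈ F, ∀ i, ¬ occursAtN a i w) ∧ x = cf01 a }

/-- The Cantor set `E₂` of reals `[0; a₁, a₂, …]` with all partial quotients in `{1,2}`. -/
noncomputable def E2 : Set ℝ :=
  { x | ∃ a : ℕ → ℕ, (∀ n, a n = 1 ∨ a n = 2) ∧ x = cf01 a }

/-! ### Continued fractions with positive partial quotients -/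

lemma cfNum_succ_eq (a : ℕ → ℕ) (n : ℕ) :
    cfNum a (n + 1) = a 0 * cfNum (fun k => a (k + 1)) n + cfDen (fun k => a (k + 1)) n := by
  induction n using Nat.twoStepInduction with
  | zero => simp [cfNum, cfDen]; ring
  | one => simp [cfNum, cfDen]; ring
  | more n ih₁ ih₂ => rw [cfNum, ih₂, ih₁, cfNum, cfDen]; ring

lemma cfDen_succ_eq (a : ℕ → ℕ) (n : ℕ) : cfDen a (n + 1) = cfNum (fun k => a (k + 1)) n := by
  induction n using Nat.twoStepInduction with
  | zero => simp [cfNum, cfDen]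
  | one => simp [cfNum, cfDen]
  | more n ih₁ ih₂ => rw [cfDen, ih₂, ih₁, cfNum]

lemma cfNum_pos {a : ℕ → ℕ} (ha : ∀ n, 1 ≤ a n) (n : ℕ) : 0 < cfNum a n := by
  induction n using Nat.twoStepInduction with
  | zero => exact ha 0
  | one => simp [cfNum]
  | more n ih₁ ih₂ => rw [cfNum]; positivity

lemma cfConv_succ {a : ℕ → ℕ} (ha : ∀ n, 1 ≤ a n) (n : ℕ) :
    (cfNum a (n + 1) : ℝ) / cfDen a (n + 1) =
      a 0 + 1 / ((cfNum (fun k => a (k + 1)) n : ℝ) / cfDen (fun k => a (k + 1)) n) := by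
  have h : (0 : ℝ) < cfNum (fun k => a (k + 1)) n := by
    exact_mod_cast cfNum_pos (fun k => ha (k + 1)) n
  rw [cfNum_succ_eq, cfDen_succ_eq]
  push_cast
  field_simp

lemma le_cfConv {a : ℕ → ℕ} (ha : ∀ n, 1 ≤ a n) (n : ℕ) :
    (a 0 : ℝ) ≤ (cfNum a n : ℝ) / cfDen a n := by
  cases n with
  | zero => simp [cfNum, cfDen]
  | succ n => rw [cfConv_succ ha]; simp only [le_add_iff_nonneg_right]; positivity

lemma one_le_cfConv {a : ℕ → ℕ} (ha : ∀ n, 1 ≤ a n) (n : ℕ) :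
    (1 : ℝ) ≤ (cfNum a n : ℝ) / cfDen a n :=
  le_trans (by exact_mod_cast ha 0) (le_cfConv ha n)

lemma cfConv_le {a : ℕ → ℕ} (ha : ∀ n, 1 ≤ a n) (n : ℕ) :
    (cfNum a n : ℝ) / cfDen a n ≤ a 0 + 1 := by
  cases n with
  | zero => simp [cfNum, cfDen]
  | succ n =>
    rw [cfConv_succ ha]
    have := one_le_cfConv (fun k => ha (k + 1)) n
    have : 1 / ((cfNum (fun k => a (k + 1)) n : ℝ) / cfDen (fun k => a (k + 1)) n) ≤ 1 := by
      rw [div_le_one (by linarith)]; exact this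
    linarith

lemma abs_one_div_add_one_div_sub_le {d y z : ℝ} (hd : 1 ≤ d) (hy : 1 ≤ y) (hz : 1 ≤ z) :
    |1 / (d + 1 / y) - 1 / (d + 1 / z)| ≤ |y - z| / 4 := by
  have hy' : 0 < y := by linarith
  have hz' : 0 < z := by linarith
  have e : 1 / (d + 1 / y) - 1 / (d + 1 / z) = (y - z) / ((d * y + 1) * (d * z + 1)) := by
    have : 0 < d * y + 1 := by positivity
    have : 0 < d * z + 1 := by positivity
    field_simp
    ring
  rw [e, abs_div]
  have h1 : 2 ≤ d * y + 1 := by nlinarith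
  have h2 : 2 ≤ d * z + 1 := by nlinarith
  rw [abs_of_pos (a := (d * y + 1) * (d * z + 1)) (by positivity)]
  exact div_le_div_of_nonneg_left (abs_nonneg _) (by norm_num) (by nlinarith)

lemma abs_cfConv_sub_le (j : ℕ) : ∀ {a : ℕ → ℕ}, (∀ n, 1 ≤ a n) → ∀ {n m : ℕ}, 2 * j ≤ n →
    2 * j ≤ m → |(cfNum a n : ℝ) / cfDen a n - (cfNum a m : ℝ) / cfDen a m| ≤ (1 / 4) ^ j := by
  induction j with
  | zero =>
    intro a ha n m _ _
    have h1 := le_cfConv ha n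
    have h2 := le_cfConv ha m
    have h3 := cfConv_le ha n
    have h4 := cfConv_le ha m
    rw [abs_le]; constructor <;> simp <;> linarith
  | succ j ih =>
    intro a ha n m hn hm
    obtain ⟨n, rfl⟩ : ∃ k, n = k + 1 + 1 := ⟨n - 2, by omega⟩
    obtain ⟨m, rfl⟩ : ∃ k, m = k + 1 + 1 := ⟨m - 2, by omega⟩
    have ha1 : ∀ n, 1 ≤ (fun k => a (k + 1)) n := fun k => ha (k + 1)
    have ha2 : ∀ n, 1 ≤ (fun k => a (k + 1 + 1)) n := fun k => ha (k + 1 + 1)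
    rw [cfConv_succ ha, cfConv_succ ha, cfConv_succ ha1, cfConv_succ ha1, add_sub_add_left_eq_sub]
    refine (abs_one_div_add_one_div_sub_le (by exact_mod_cast ha1 0) (one_le_cfConv ha2 n)
      (one_le_cfConv ha2 m)).trans ?_
    have := ih ha2 (n := n) (m := m) (by omega) (by omega)
    rw [pow_succ]; linarith

lemma tendsto_cfVal {a : ℕ → ℕ} (ha : ∀ n, 1 ≤ a n) :
    Tendsto (fun n => (cfNum a n : ℝ) / cfDen a n) atTop (nhds (cfVal a)) := by
  refine CauchySeq.tendsto_limUnder (Metric.cauchySeq_iff.2 fun ε hε => ?_)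
  obtain ⟨j, hj⟩ := exists_pow_lt_of_lt_one hε (by norm_num : (1 / 4 : ℝ) < 1)
  exact ⟨2 * j, fun m hm n hn => (abs_cfConv_sub_le j ha hm hn).trans_lt hj⟩

lemma one_le_cfVal {a : ℕ → ℕ} (ha : ∀ n, 1 ≤ a n) : 1 ≤ cfVal a :=
  ge_of_tendsto' (tendsto_cfVal ha) (one_le_cfConv ha)

lemma cfVal_eq {a : ℕ → ℕ} (ha : ∀ n, 1 ≤ a n) :
    cfVal a = a 0 + cf01 (fun k => a (k + 1)) := by
  have ha1 : ∀ n, 1 ≤ (fun k => a (k + 1)) n := fun k => ha (k + 1)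
  refine tendsto_nhds_unique ((tendsto_add_atTop_iff_nat 1).2 (tendsto_cfVal ha)) ?_
  simp_rw [cfConv_succ ha]
  have h := one_le_cfVal ha1
  exact tendsto_const_nhds.add (tendsto_const_nhds.div (tendsto_cfVal ha1) (by linarith))

lemma cf01_eq {a : ℕ → ℕ} (ha : ∀ n, 1 ≤ a n) :
    cf01 a = 1 / (a 0 + cf01 (fun k => a (k + 1))) := by
  rw [cf01, cfVal_eq ha]

lemma cf01_pos {a : ℕ → ℕ} (ha : ∀ n, 1 ≤ a n) : 0 < cf01 a := by
  have := one_le_cfVal ha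
  rw [cf01]; positivity

lemma cf01_le_one {a : ℕ → ℕ} (ha : ∀ n, 1 ≤ a n) : cf01 a ≤ 1 := by
  have := one_le_cfVal ha
  rw [cf01]; exact div_le_one_of_le₀ this (by linarith)

lemma abs_cf01_sub_le (j : ℕ) : ∀ {a b : ℕ → ℕ}, (∀ n, 1 ≤ a n) → (∀ n, 1 ≤ b n) →
    (∀ i < 2 * j, a i = b i) → |cf01 a - cf01 b| ≤ (1 / 4) ^ j := by
  induction j with
  | zero =>
    intro a b ha hb _
    have h1 := cf01_pos ha
    have h2 := cf01_pos hb
    have h3 := cf01_le_one ha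
    have h4 := cf01_le_one hb
    rw [abs_le]; constructor <;> simp <;> linarith
  | succ j ih =>
    intro a b ha hb hab
    have ha1 : ∀ n, 1 ≤ (fun k => a (k + 1)) n := fun k => ha (k + 1)
    have ha2 : ∀ n, 1 ≤ (fun k => a (k + 1 + 1)) n := fun k => ha (k + 1 + 1)
    have hb1 : ∀ n, 1 ≤ (fun k => b (k + 1)) n := fun k => hb (k + 1)
    have hb2 : ∀ n, 1 ≤ (fun k => b (k + 1 + 1)) n := fun k => hb (k + 1 + 1)
    have h := abs_one_div_add_one_div_sub_le (d := a 0) (y := cfVal (fun k => a (k + 1)))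
      (z := cfVal (fun k => b (k + 1))) (by exact_mod_cast ha 0) (one_le_cfVal ha1)
      (one_le_cfVal hb1)
    have e1 : cf01 a = 1 / (a 0 + 1 / cfVal (fun k => a (k + 1))) := cf01_eq ha
    have e2 : cf01 b = 1 / (a 0 + 1 / cfVal (fun k => b (k + 1))) := by
      rw [hab 0 (by omega)]; exact cf01_eq hb
    rw [e1, e2]
    refine h.trans ?_
    rw [cfVal_eq ha1, cfVal_eq hb1]
    have := ih ha2 hb2 (fun i hi => hab _ (by omega))
    rw [hab (0 + 1) (by omega), add_sub_add_left_eq_sub, pow_succ]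
    linarith

/-! ### Rational polynomials as coefficient lists -/

/-- Value at `x` of the polynomial with coefficient list `l` (constant term first). -/
noncomputable def peval (l : List ℚ) (x : ℝ) : ℝ := l.foldr (fun c r => c + x * r) 0

@[simp] lemma peval_nil (x : ℝ) : peval [] x = 0 := rfl

@[simp] lemma peval_cons (c : ℚ) (l : List ℚ) (x : ℝ) : peval (c :: l) x = c + x * peval l x := rfl

/-- Sum of two coefficient lists. -/
def padd : List ℚ → List ℚ → List ℚ
  | [], m => m
  | l, [] => l
  | c :: l, d :: m => (c + d) :: padd l m

lemma peval_padd (l m : List ℚ) (x : ℝ) : peval (padd l m) x = peval l x + peval m x := by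
  fun_induction padd l m with
  | case1 => simp
  | case2 => simp
  | case3 c l d m ih => simp only [peval_cons, ih]; push_cast; ring

/-- Scalar multiple of a coefficient list. -/
def psmul (c : ℚ) (l : List ℚ) : List ℚ := l.map (c * ·)

lemma peval_psmul (c : ℚ) (l : List ℚ) (x : ℝ) : peval (psmul c l) x = c * peval l x := by
  induction l with
  | nil => simp [psmul]
  | cons d l ih =>
    have : psmul c (d :: l) = (c * d) :: psmul c l := rfl
    rw [this, peval_cons, peval_cons, ih]; push_cast; ring

/-- Product of two coefficient lists. -/
def pmul : List ℚ → List ℚ → List ℚ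
  | [], _ => []
  | c :: l, m => padd (psmul c m) (0 :: pmul l m)

lemma peval_pmul (l m : List ℚ) (x : ℝ) : peval (pmul l m) x = peval l x * peval m x := by
  induction l with
  | nil => simp [pmul]
  | cons c l ih => simp only [pmul, peval_padd, peval_psmul, peval_cons, ih]; push_cast; ring

/-- Power of a coefficient list. -/
def ppow (l : List ℚ) : ℕ → List ℚ
  | 0 => [1]
  | n + 1 => pmul l (ppow l n)

lemma peval_ppow (l : List ℚ) (n : ℕ) (x : ℝ) : peval (ppow l n) x = peval l x ^ n := by
  induction n with
  | zero => simp [ppow]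
  | succ n ih => rw [ppow, peval_pmul, ih, pow_succ']

/-- Numerator of the composition of `l` with the fraction `A / B`. -/
def pcomp (A B : List ℚ) : List ℚ → List ℚ
  | [] => []
  | c :: l => padd (psmul c (ppow B l.length)) (pmul A (pcomp A B l))

lemma peval_pcomp_mul (A B l : List ℚ) (x : ℝ) (hB : peval B x ≠ 0) :
    peval (pcomp A B l) x * peval B x = peval B x ^ l.length * peval l (peval A x / peval B x) := by
  induction l with
  | nil => simp [pcomp]
  | cons c l ih =>
    have e : peval (pcomp A B (c :: l)) x =
        c * peval B x ^ l.length + peval A x * peval (pcomp A B l) x := by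
      rw [pcomp, peval_padd, peval_psmul, peval_ppow, peval_pmul]
    rw [e, add_mul, mul_assoc (peval A x), ih, List.length_cons, peval_cons, pow_succ]
    field_simp

/-- Bound for the absolute value of a polynomial on `[-h, h]`. -/
def pbound (h : ℚ) (l : List ℚ) : ℚ := l.foldr (fun c r => |c| + h * r) 0

lemma abs_peval_le {h : ℚ} {x : ℝ} (hx : |x| ≤ h) (l : List ℚ) : |peval l x| ≤ pbound h l := by
  induction l with
  | nil => simp [pbound]
  | cons c l ih =>
    have : pbound h (c :: l) = |c| + h * pbound h l := rfl
    rw [peval_cons, this]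
    push_cast
    refine (abs_add_le _ _).trans (add_le_add le_rfl ?_)
    rw [abs_mul]
    exact mul_le_mul hx ih (abs_nonneg _) ((abs_nonneg _).trans hx)

/-- Sufficient test for the positivity of a polynomial on `[a - h, a + h]`. -/
def ppos (a h : ℚ) (l : List ℚ) : Bool :=
  match pcomp [a, 1] [1] l with
  | [] => false
  | c :: m => decide (h * pbound h m ≤ c)

lemma peval_nonneg_of_ppos {a h : ℚ} {l : List ℚ} (hl : ppos a h l = true) {x : ℝ}
    (hx : |x - a| ≤ h) : 0 ≤ peval l x := by
  have e : peval l x = peval (pcomp [a, 1] [1] l) (x - a) := by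
    have := peval_pcomp_mul [a, 1] [1] l (x - a) (by simp)
    simpa using this.symm
  rw [e]
  unfold ppos at hl
  split at hl
  · simp at hl
  · next c m hm =>
    have h1 : h * pbound h m ≤ c := by simpa using hl
    have h1' : (h : ℝ) * pbound h m ≤ c := by exact_mod_cast h1
    rw [hm, peval_cons]
    have h2 := abs_peval_le hx m
    have h3 : |(x - a) * peval m (x - a)| ≤ h * pbound h m := by
      rw [abs_mul]
      exact mul_le_mul hx h2 (abs_nonneg _) ((abs_nonneg _).trans hx)
    have h4 := neg_abs_le ((x - a) * peval m (x - a))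
    linarith

/-! ### A positive eigenfunction estimate for the transfer operator of `E2` -/

/-- An upper Taylor-type polynomial for `v ↦ (1 + v) ^ (-θ)`. -/
noncomputable def invRpowPoly (θ v : ℝ) : ℝ :=
  1 - θ * v + θ * (θ + 1) / 2 * v ^ 2 - θ * (θ + 1) * (θ + 2) / 6 * v ^ 3
    + θ * (θ + 1) * (θ + 2) * (θ + 3) / 24 * v ^ 4
    - θ * (θ + 1) * (θ + 2) * (θ + 3) * (θ + 4) / 120 * v ^ 5
    + θ * (θ + 1) * (θ + 2) * (θ + 3) * (θ + 4) * (θ + 5) / 720 * v ^ 6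
    - θ * (θ + 1) * (θ + 2) * (θ + 3) * (θ + 4) * (θ + 5) * (θ + 6) / 5040 * v ^ 7
    + 119 / 100 * (θ * (θ + 1) * (θ + 2) * (θ + 3) * (θ + 4) * (θ + 5) * (θ + 6) * (θ + 7) / 40320)
      * v ^ 8

lemma hasDerivAt_rpow_mul_invRpowPoly (θ : ℝ) {v : ℝ} (hv : -1 < v) :
    HasDerivAt (fun v => (1 + v) ^ θ * invRpowPoly θ v)
      ((1 + v) ^ (θ - 1) * (θ * (θ + 1) * (θ + 2) * (θ + 3) * (θ + 4) * (θ + 5) * (θ + 6)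
        * (θ + 7) / 40320 * (v ^ 7 * (152 / 100 + 119 / 100 * (θ + 8) * v)))) v := by
  have h0 : (1 + v) ≠ 0 := by linarith
  have h1 : HasDerivAt (fun v : ℝ => (1 + v) ^ θ) (1 * θ * (1 + v) ^ (θ - 1)) v :=
    ((hasDerivAt_id v).const_add 1).rpow_const (Or.inl h0)
  have hp : ∀ (c : ℝ) (n : ℕ), HasDerivAt (fun v : ℝ => c * v ^ (n + 1))
      (c * ((n + 1 : ℕ) * v ^ n)) v := fun c n => by
    simpa using (hasDerivAt_pow (n + 1) v).const_mul c
  have h2 : HasDerivAt (invRpowPoly θ) _ v :=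
    (((((((((hasDerivAt_const v (1 : ℝ)).fun_sub ((hasDerivAt_id' v).const_mul θ)).fun_add
      (hp (θ * (θ + 1) / 2) 1)).fun_sub (hp (θ * (θ + 1) * (θ + 2) / 6) 2)).fun_add
      (hp (θ * (θ + 1) * (θ + 2) * (θ + 3) / 24) 3)).fun_sub
      (hp (θ * (θ + 1) * (θ + 2) * (θ + 3) * (θ + 4) / 120) 4)).fun_add
      (hp (θ * (θ + 1) * (θ + 2) * (θ + 3) * (θ + 4) * (θ + 5) / 720) 5)).fun_sub
      (hp (θ * (θ + 1) * (θ + 2) * (θ + 3) * (θ + 4) * (θ + 5) * (θ + 6) / 5040) 6)).fun_add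
      (hp (119 / 100 * (θ * (θ + 1) * (θ + 2) * (θ + 3) * (θ + 4) * (θ + 5) * (θ + 6) * (θ + 7)
        / 40320)) 7))
  refine (h1.fun_mul h2).congr_deriv ?_
  have e : (1 + v) ^ θ = (1 + v) ^ (θ - 1) * (1 + v) := by
    rw [← Real.rpow_add_one h0]; congr 1; ring
  rw [e, invRpowPoly]
  push_cast
  ring

lemma one_le_rpow_mul_invRpowPoly {θ v : ℝ} (h0 : 0 ≤ θ) (h1 : θ ≤ 107 / 100)
    (hv : |v| ≤ 14 / 100) : 1 ≤ (1 + v) ^ θ * invRpowPoly θ v := by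
  obtain ⟨hv1, hv2⟩ := abs_le.1 hv
  set φ : ℝ → ℝ := fun v => (1 + v) ^ θ * invRpowPoly θ v with hφ
  have hd : ∀ x : ℝ, -1 < x → HasDerivAt φ _ x := fun x hx => hasDerivAt_rpow_mul_invRpowPoly θ hx
  have hφ0 : φ 0 = 1 := by simp [hφ, invRpowPoly]
  change 1 ≤ φ v
  rw [← hφ0]
  have key : ∀ x : ℝ, -(14 / 100) ≤ x → 0 ≤ 152 / 100 + 119 / 100 * (θ + 8) * x := by
    intro x hx; nlinarith
  rcases le_total 0 v with h | h
  · have hm : MonotoneOn φ (Set.Icc 0 v) := by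
      refine monotoneOn_of_deriv_nonneg (convex_Icc _ _)
        (fun x hx => (hd x (by linarith [hx.1])).continuousAt.continuousWithinAt)
        (fun x hx => ?_) (fun x hx => ?_) <;> rw [interior_Icc] at hx
      · exact (hd x (by linarith [hx.1])).differentiableAt.differentiableWithinAt
      · rw [(hd x (by linarith [hx.1])).deriv]
        have := key x (by linarith [hx.1])
        have := hx.1
        have : 0 < 1 + x := by linarith
        positivity
    exact hm (Set.left_mem_Icc.2 h) (Set.right_mem_Icc.2 h) h
  · have hm : AntitoneOn φ (Set.Icc v 0) := by
      refine antitoneOn_of_deriv_nonpos (convex_Icc _ _)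
        (fun x hx => (hd x (by linarith [hx.1])).continuousAt.continuousWithinAt)
        (fun x hx => ?_) (fun x hx => ?_) <;> rw [interior_Icc] at hx
      · exact (hd x (by linarith [hx.1])).differentiableAt.differentiableWithinAt
      · rw [(hd x (by linarith [hx.1])).deriv]
        have h3 := key x (by linarith [hx.1])
        have h4 := hx.2
        have : 0 < 1 + x := by linarith [hx.1]
        have h7 : x ^ 7 ≤ 0 := Odd.pow_nonpos (by decide) h4.le
        refine mul_nonpos_of_nonneg_of_nonpos (by positivity)
          (mul_nonpos_of_nonneg_of_nonpos (by positivity) (mul_nonpos_of_nonpos_of_nonneg h7 h3))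
    exact hm (Set.left_mem_Icc.2 h) (Set.right_mem_Icc.2 h) h

/-- Twice the dimension bound for `E2`. -/
def thetaE2 : ℚ := 2157 / 2030

/-- Coefficients of `invRpowPoly thetaE2 (t / u)` in the variable `t`. -/
def invRpowList (u : ℚ) : List ℚ :=
  let θ := thetaE2
  [1, -(θ / u), θ * (θ + 1) / 2 / u ^ 2, -(θ * (θ + 1) * (θ + 2) / 6 / u ^ 3),
    θ * (θ + 1) * (θ + 2) * (θ + 3) / 24 / u ^ 4,
    -(θ * (θ + 1) * (θ + 2) * (θ + 3) * (θ + 4) / 120 / u ^ 5),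
    θ * (θ + 1) * (θ + 2) * (θ + 3) * (θ + 4) * (θ + 5) / 720 / u ^ 6,
    -(θ * (θ + 1) * (θ + 2) * (θ + 3) * (θ + 4) * (θ + 5) * (θ + 6) / 5040 / u ^ 7),
    119 / 100 * (θ * (θ + 1) * (θ + 2) * (θ + 3) * (θ + 4) * (θ + 5) * (θ + 6) * (θ + 7) / 40320)
      / u ^ 8]

lemma peval_invRpowList (u : ℚ) (t : ℝ) :
    peval (invRpowList u) t = invRpowPoly thetaE2 (t / u) := by
  simp only [invRpowList, peval_cons, peval_nil, invRpowPoly]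
  push_cast
  ring

lemma rpow_neg_le_of_center {u K : ℚ} {t : ℝ} (hu : 0 < u) (hK : 0 ≤ K)
    (hKu : (1 / u) ^ 2157 ≤ K ^ 2030) (ht : |t| ≤ 14 / 100 * u) :
    ((u : ℝ) + t) ^ (-(thetaE2 : ℝ)) ≤ K * peval (invRpowList u) t := by
  have hu' : (0 : ℝ) < u := by exact_mod_cast hu
  have hv : |t / u| ≤ 14 / 100 := by rw [abs_div, abs_of_pos hu', div_le_iff₀ hu']; exact ht
  have hv' : 0 < 1 + t / u := by linarith [(abs_le.1 hv).1]
  have h1 := one_le_rpow_mul_invRpowPoly (θ := (thetaE2 : ℝ)) (by norm_num [thetaE2])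
    (by norm_num [thetaE2]) hv
  rw [← peval_invRpowList] at h1
  have e : (u : ℝ) + t = u * (1 + t / u) := by field_simp
  have h2 : (u : ℝ) ^ (-(thetaE2 : ℝ)) ≤ K := by
    have hK' : (0 : ℝ) ≤ K := by exact_mod_cast hK
    have h3 : ((u : ℝ) ^ (-(thetaE2 : ℝ))) ^ 2030 ≤ (K : ℝ) ^ 2030 := by
      rw [← Real.rpow_mul_natCast hu'.le]
      have : -(thetaE2 : ℝ) * (2030 : ℕ) = -((2157 : ℕ) : ℝ) := by norm_num [thetaE2]
      rw [this, Real.rpow_neg hu'.le, Real.rpow_natCast]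
      have : ((1 / u : ℚ) : ℝ) ^ 2157 ≤ (K : ℝ) ^ 2030 := by exact_mod_cast hKu
      simpa using this
    exact le_of_pow_le_pow_left₀ (by norm_num) hK' h3
  rw [e, Real.mul_rpow hu'.le hv'.le]
  refine mul_le_mul h2 ?_ (by positivity) (by exact_mod_cast hK)
  rw [Real.rpow_neg hv'.le, inv_le_iff_one_le_mul₀' (by positivity)]
  exact h1

/-- Coefficients, in the variable `x - 27 / 50`, of an approximate eigenfunction of the transfer
operator. -/
def eigenList : List ℚ :=
  [1, -(11123479 / 25000000), 19932681 / 100000000, -(9125393 / 100000000), 4326397 / 100000000,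
    -(1018211 / 50000000)]

/-- An approximate eigenfunction of the transfer operator of `E2`. -/
noncomputable def eigenFun (x : ℝ) : ℝ := peval eigenList (x - 27 / 50)

/-- Numerator of `eigenFun (1 / (u + t)) * (u + t) ^ 5` in the variable `t`. -/
def eigenBranch (u : ℚ) : List ℚ := pcomp [1 - 27 / 50 * u, -(27 / 50)] [u, 1] eigenList

lemma eigenFun_one_div {u : ℚ} {t : ℝ} (hu : (u : ℝ) + t ≠ 0) :
    eigenFun (1 / (u + t)) = peval (eigenBranch u) t / (u + t) ^ 5 := by
  have hB : peval [u, 1] t = u + t := by simp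
  have hA : peval [1 - 27 / 50 * u, -(27 / 50)] t / peval [u, 1] t = 1 / (u + t) - 27 / 50 := by
    rw [hB]; simp; field_simp; ring
  have h := peval_pcomp_mul [1 - 27 / 50 * u, -(27 / 50)] [u, 1] eigenList t (by rwa [hB])
  rw [hA, hB] at h
  rw [eigenFun, eigenBranch, eq_div_iff (pow_ne_zero 5 hu)]
  have e : eigenList.length = 5 + 1 := rfl
  rw [e, pow_succ] at h
  exact mul_right_cancel₀ hu (by linear_combination -h)

/-- The numerator of the defect of `eigenFun` under the transfer operator. -/
def eigenDefect : List ℚ :=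
  padd (pmul eigenList (pmul (ppow [77 / 50, 1] 5) (ppow [127 / 50, 1] 5)))
    (psmul (-1) (padd
      (pmul (psmul (12640891 / 20000000) (invRpowList (77 / 50)))
        (pmul (eigenBranch (77 / 50)) (ppow [127 / 50, 1] 5)))
      (pmul (psmul (18569887 / 50000000) (invRpowList (127 / 50)))
        (pmul (eigenBranch (127 / 50)) (ppow [77 / 50, 1] 5)))))

lemma eigenDefect_ppos : ppos (-(63 / 400)) (21 / 400) eigenDefect = true ∧
    ppos (-(21 / 400)) (21 / 400) eigenDefect = true ∧
    ppos (21 / 400) (21 / 400) eigenDefect = true ∧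
    ppos (63 / 400) (21 / 400) eigenDefect = true := by
  decide +kernel

lemma one_div_div_pow_le {a b c d m n : ℕ} (ha : 0 < a) (hb : 0 < b) (hd : 0 < d)
    (h : b ^ m * d ^ n ≤ c ^ n * a ^ m) : ((1 : ℚ) / (a / b)) ^ m ≤ (c / d) ^ n := by
  have ha' : (0 : ℚ) < a := by exact_mod_cast ha
  have hb' : (0 : ℚ) < b := by exact_mod_cast hb
  have hd' : (0 : ℚ) < d := by exact_mod_cast hd
  rw [one_div_div, div_pow, div_pow, div_le_div_iff₀ (by positivity) (by positivity)]
  exact_mod_cast h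

lemma eigenFun_center_bounds :
    ((1 : ℚ) / (77 / 50)) ^ 2157 ≤ (12640891 / 20000000) ^ 2030 ∧
    ((1 : ℚ) / (127 / 50)) ^ 2157 ≤ (18569887 / 50000000) ^ 2030 := by
  have h1 := one_div_div_pow_le (a := 77) (b := 50) (c := 12640891) (d := 20000000) (m := 2157)
    (n := 2030) (by norm_num) (by norm_num) (by norm_num) (by decide +kernel)
  have h2 := one_div_div_pow_le (a := 127) (b := 50) (c := 18569887) (d := 50000000) (m := 2157)
    (n := 2030) (by norm_num) (by norm_num) (by norm_num) (by decide +kernel)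
  simp only [Nat.cast_ofNat] at h1 h2
  exact ⟨h1, h2⟩

lemma eigenDefect_nonneg {t : ℝ} (ht : |t| ≤ 21 / 100) : 0 ≤ peval eigenDefect t := by
  obtain ⟨h1, h2⟩ := abs_le.1 ht
  obtain ⟨p1, p2, p3, p4⟩ := eigenDefect_ppos
  rcases le_total t (-(21 / 200)) with h | h
  · exact peval_nonneg_of_ppos p1 (by rw [abs_le]; push_cast; constructor <;> linarith)
  rcases le_total t 0 with h | h
  · exact peval_nonneg_of_ppos p2 (by rw [abs_le]; push_cast; constructor <;> linarith)
  rcases le_total t (21 / 200) with h | h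
  · exact peval_nonneg_of_ppos p3 (by rw [abs_le]; push_cast; constructor <;> linarith)
  · exact peval_nonneg_of_ppos p4 (by rw [abs_le]; push_cast; constructor <;> linarith)

lemma half_le_eigenFun {x : ℝ} (h1 : 1 / 3 ≤ x) (h2 : x ≤ 3 / 4) :
    1 / 2 ≤ eigenFun x := by
  have hx : |x - 27 / 50| ≤ (21 / 100 : ℚ) := by rw [abs_le]; push_cast; constructor <;> linarith
  have e : eigenFun x = 1 + (x - 27 / 50) * peval eigenList.tail (x - 27 / 50) := by
    simp [eigenFun, eigenList]
  have h := abs_peval_le hx eigenList.tail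
  have hb : pbound (21 / 100) eigenList.tail ≤ 1 := by decide +kernel
  have hb' : (pbound (21 / 100) eigenList.tail : ℝ) ≤ 1 := by exact_mod_cast hb
  have h3 : |(x - 27 / 50) * peval eigenList.tail (x - 27 / 50)| ≤ 21 / 100 * 1 := by
    rw [abs_mul]
    push_cast at hx
    exact mul_le_mul hx (h.trans hb') (abs_nonneg _) (by norm_num)
  linarith [(abs_le.1 h3).1]

/-- `eigenFun` is a subinvariant function of the transfer operator. -/
lemma transfer_eigenFun_le {x : ℝ} (h1 : 1 / 3 ≤ x) (h2 : x ≤ 3 / 4) :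
    (1 + x) ^ (-(thetaE2 : ℝ)) * eigenFun (1 / (1 + x)) +
      (2 + x) ^ (-(thetaE2 : ℝ)) * eigenFun (1 / (2 + x)) ≤ eigenFun x := by
  obtain ⟨t, rfl⟩ : ∃ t, x = 27 / 50 + t := ⟨x - 27 / 50, by ring⟩
  have ht : |t| ≤ 21 / 100 := by rw [abs_le]; constructor <;> linarith
  obtain ⟨k1, k2⟩ := eigenFun_center_bounds
  have r1 := rpow_neg_le_of_center (t := t) (by norm_num) (by norm_num) k1
    (by push_cast; linarith)
  have r2 := rpow_neg_le_of_center (t := t) (by norm_num) (by norm_num) k2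
    (by push_cast; linarith)
  have e1 : (1 : ℝ) + (27 / 50 + t) = (77 / 50 : ℚ) + t := by push_cast; ring
  have e2 : (2 : ℝ) + (27 / 50 + t) = (127 / 50 : ℚ) + t := by push_cast; ring
  have p1 : (0 : ℝ) < (77 / 50 : ℚ) + t := by rw [← e1]; linarith
  have p2 : (0 : ℝ) < (127 / 50 : ℚ) + t := by rw [← e2]; linarith
  have q1 := half_le_eigenFun (x := 1 / (1 + (27 / 50 + t)))
    (by rw [le_div_iff₀] <;> linarith) (by rw [div_le_iff₀] <;> linarith)
  have q2 := half_le_eigenFun (x := 1 / (2 + (27 / 50 + t)))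
    (by rw [le_div_iff₀] <;> linarith) (by rw [div_le_iff₀] <;> linarith)
  rw [e1] at q1 ⊢
  rw [e2] at q2 ⊢
  refine (add_le_add (mul_le_mul_of_nonneg_right r1 (by linarith))
    (mul_le_mul_of_nonneg_right r2 (by linarith))).trans ?_
  rw [eigenFun_one_div p1.ne', eigenFun_one_div p2.ne']
  have h := eigenDefect_nonneg ht
  have l1 : peval [77 / 50, 1] t = (77 / 50 : ℚ) + t := by simp
  have l2 : peval [127 / 50, 1] t = (127 / 50 : ℚ) + t := by simp
  simp only [eigenDefect, peval_padd, peval_psmul, peval_pmul, peval_ppow, l1, l2] at h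
  have e3 : eigenFun (27 / 50 + t) = peval eigenList t := by rw [eigenFun]; congr 1; ring
  rw [e3]
  have d1 := pow_pos p1 5
  have d2 := pow_pos p2 5
  rw [← sub_nonneg]
  refine le_of_mul_le_mul_right ?_ (mul_pos d1 d2)
  rw [zero_mul]
  refine h.trans_eq ?_
  field_simp
  push_cast
  ring

/-! ### Möbius images and covers -/

lemma hausdorffMeasure_le_of_covers {A : Set ℝ} {s : ℝ} (hs : 0 ≤ s) {C : ENNReal}
    {δ : ℕ → ENNReal} (hδ : Tendsto δ atTop (nhds 0))
    (h : ∀ n, ∃ (ι : Type) (_ : Countable ι) (t : ι → Set ℝ) (w : ι → ENNReal),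
      (∀ i, w i ≤ δ n ∧ Metric.ediam (t i) ≤ w i) ∧ A ⊆ ⋃ i, t i ∧ ∑' i, w i ^ s ≤ C) :
    MeasureTheory.Measure.hausdorffMeasure s A ≤ C := by
  choose ι hι t w hw hA hsum using h
  refine (MeasureTheory.Measure.hausdorffMeasure_le_liminf_tsum s A δ hδ t
    (Eventually.of_forall fun n i => (hw n i).2.trans (hw n i).1)
    (Eventually.of_forall hA)).trans ?_
  have hle : ∀ n, ∑' i, Metric.ediam (t n i) ^ s ≤ C := fun n =>
    (ENNReal.tsum_le_tsum fun i => ENNReal.rpow_le_rpow (hw n i).2 hs).trans (hsum n)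
  exact (liminf_le_liminf (Eventually.of_forall hle)).trans_eq (liminf_const C)

/-- The Möbius map `x ↦ (p + p' x) / (q + q' x)`. -/
noncomputable def mob (p p' q q' x : ℝ) : ℝ := (p + p' * x) / (q + q' * x)

lemma mob_one_div {p p' q q' d x : ℝ} (hdx : 0 < d + x) :
    mob p p' q q' (1 / (d + x)) = mob (d * p + p') p (d * q + q') q x := by
  have h1 : p + p' * (1 / (d + x)) = (d * p + p' + p * x) / (d + x) := by field_simp; ring
  have h2 : q + q' * (1 / (d + x)) = (d * q + q' + q * x) / (d + x) := by field_simp; ring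
  rw [mob, mob, h1, h2, div_div_div_cancel_right₀ hdx.ne']

lemma abs_mob_sub_le {p p' q q' x y : ℝ} (hdet : |p * q' - p' * q| = 1) (hq : 0 < q)
    (hq' : 0 ≤ q') (hx : x ∈ Set.Icc (0 : ℝ) 1) (hy : y ∈ Set.Icc (0 : ℝ) 1) :
    |mob p p' q q' x - mob p p' q q' y| ≤ 1 / (q * (q + q')) := by
  obtain ⟨hx0, hx1⟩ := hx
  obtain ⟨hy0, hy1⟩ := hy
  have dx : 0 < q + q' * x := by positivity
  have dy : 0 < q + q' * y := by positivity
  have e : mob p p' q q' x - mob p p' q q' y =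
      (p * q' - p' * q) * (y - x) / ((q + q' * x) * (q + q' * y)) := by
    rw [mob, mob, div_sub_div _ _ dx.ne' dy.ne']; congr 1; ring
  rw [e, abs_div, abs_mul, hdet, one_mul, abs_of_pos (mul_pos dx dy),
    div_le_div_iff₀ (mul_pos dx dy) (by positivity)]
  have hxy : |y - x| ≤ 1 := by rw [abs_le]; constructor <;> linarith
  have hxy' : |y - x| ≤ x + y := by rw [abs_le]; constructor <;> linarith
  have h1 := mul_le_mul_of_nonneg_right hxy (sq_nonneg q)
  have h2 := mul_le_mul_of_nonneg_right hxy' (mul_nonneg hq.le hq')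
  have h3 : 0 ≤ q' ^ 2 * (x * y) := by positivity
  nlinarith

lemma ediam_mob_image_le {p p' q q' : ℝ} (hdet : |p * q' - p' * q| = 1) (hq : 0 < q)
    (hq' : 0 ≤ q') {S : Set ℝ} (hS : S ⊆ Set.Icc 0 1) :
    Metric.ediam ((mob p p' q q') '' S) ≤ ENNReal.ofReal (1 / (q * (q + q'))) := by
  refine Metric.ediam_le ?_
  rintro _ ⟨x, hx, rfl⟩ _ ⟨y, hy, rfl⟩
  rw [edist_dist, Real.dist_eq]
  exact ENNReal.ofReal_le_ofReal (abs_mob_sub_le hdet hq hq' (hS hx) (hS hy))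

lemma abs_det_step {p p' q q' : ℝ} (d : ℝ) (hdet : |p * q' - p' * q| = 1) :
    |(d * p + p') * q - p * (d * q + q')| = 1 := by
  rw [← hdet, ← abs_neg]; congr 1; ring

lemma E2_subset_Icc : E2 ⊆ Set.Icc 0 1 := by
  rintro _ ⟨a, ha, rfl⟩
  have ha' : ∀ n, 1 ≤ a n := fun n => by rcases ha n with h | h <;> omega
  exact ⟨(cf01_pos ha').le, cf01_le_one ha'⟩

lemma exists_of_mem_E2 {x : ℝ} (hx : x ∈ E2) : ∃ y ∈ E2, x = 1 / (1 + y) ∨ x = 1 / (2 + y) := by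
  obtain ⟨a, ha, rfl⟩ := hx
  refine ⟨cf01 fun k => a (k + 1), ⟨_, fun n => ha (n + 1), rfl⟩, ?_⟩
  rw [cf01_eq fun n => by rcases ha n with h | h <;> omega]
  rcases ha 0 with h | h <;> simp [h]

lemma mob_image_E2_subset {p p' q q' : ℝ} : (mob p p' q q') '' E2 ⊆
    mob (1 * p + p') p (1 * q + q') q '' E2 ∪ mob (2 * p + p') p (2 * q + q') q '' E2 := by
  rintro _ ⟨x, hx, rfl⟩
  obtain ⟨y, hy, rfl | rfl⟩ := exists_of_mem_E2 hx
  · exact Or.inl ⟨y, hy, (mob_one_div (by linarith [(E2_subset_Icc hy).1])).symm⟩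
  · exact Or.inr ⟨y, hy, (mob_one_div (by linarith [(E2_subset_Icc hy).1])).symm⟩

lemma exists_cover_mob_image_E2 (n : ℕ) : ∀ {p p' q q' : ℝ}, |p * q' - p' * q| = 1 → 0 < q →
    q ≤ 3 * q' → 4 * q' ≤ 3 * q →
    ∃ (ι : Type) (_ : Fintype ι) (t : ι → Set ℝ) (w : ι → ℝ),
      (∀ i, 0 ≤ w i ∧ w i ≤ (9 / 16) ^ n / q ^ 2 ∧
        Metric.ediam (t i) ≤ ENNReal.ofReal (w i)) ∧
      (mob p p' q q') '' E2 ⊆ ⋃ i, t i ∧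
      ∑ i, w i ^ ((thetaE2 : ℝ) / 2) ≤ 2 * (q ^ (-(thetaE2 : ℝ)) * eigenFun (q' / q)) := by
  induction n with
  | zero =>
    intro p p' q q' hdet hq h1 h2
    refine ⟨Unit, inferInstance, fun _ => (mob p p' q q') '' E2, fun _ => 1 / q ^ 2,
      fun _ => ⟨by positivity, by simp, ?_⟩,
      fun x hx => Set.mem_iUnion.2 ⟨(), hx⟩, ?_⟩
    · refine (ediam_mob_image_le hdet hq (by linarith) E2_subset_Icc).trans
        (ENNReal.ofReal_le_ofReal ?_)
      exact one_div_le_one_div_of_le (by positivity) (by nlinarith)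
    · have hf := half_le_eigenFun (x := q' / q) (by rw [le_div_iff₀ hq]; linarith)
        (by rw [div_le_iff₀ hq]; linarith)
      have e : (1 / q ^ 2) ^ ((thetaE2 : ℝ) / 2) = q ^ (-(thetaE2 : ℝ)) := by
        rw [one_div, ← Real.rpow_natCast, ← Real.rpow_neg hq.le, ← Real.rpow_mul hq.le]
        congr 1; push_cast; ring
      have hp : 0 < q ^ (-(thetaE2 : ℝ)) := by positivity
      simp only [Finset.univ_unique, Finset.sum_const, Finset.card_singleton, one_smul, e]
      nlinarith
  | succ n ih =>
    intro p p' q q' hdet hq h1 h2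
    have hq' : 0 < q' := by linarith
    obtain ⟨ι₁, _, t₁, w₁, hw₁, hc₁, hs₁⟩ := ih (abs_det_step 1 hdet) (q := 1 * q + q') (q' := q)
      (by positivity) (by linarith) (by linarith)
    obtain ⟨ι₂, _, t₂, w₂, hw₂, hc₂, hs₂⟩ := ih (abs_det_step 2 hdet) (q := 2 * q + q') (q' := q)
      (by positivity) (by linarith) (by linarith)
    have hw : ∀ {d : ℝ}, 1 ≤ d → (9 / 16 : ℝ) ^ n / (d * q + q') ^ 2 ≤
        (9 / 16) ^ (n + 1) / q ^ 2 := by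
      intro d hd
      have h3 : (4 / 3 * q) ^ 2 ≤ (d * q + q') ^ 2 :=
        pow_le_pow_left₀ (by positivity) (by nlinarith) 2
      rw [div_le_div_iff₀ (by positivity) (by positivity), pow_succ (9 / 16 : ℝ) n,
        mul_assoc]
      exact mul_le_mul_of_nonneg_left (by linarith) (by positivity)
    refine ⟨ι₁ ⊕ ι₂, inferInstance, Sum.elim t₁ t₂, Sum.elim w₁ w₂, ?_, ?_, ?_⟩
    · rintro (i | i)
      · exact ⟨(hw₁ i).1, (hw₁ i).2.1.trans (hw le_rfl), (hw₁ i).2.2⟩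
      · exact ⟨(hw₂ i).1, (hw₂ i).2.1.trans (hw (by norm_num)), (hw₂ i).2.2⟩
    · rw [Set.iUnion_sum]
      exact mob_image_E2_subset.trans (Set.union_subset_union hc₁ hc₂)
    · rw [Fintype.sum_sum_type]
      refine (add_le_add hs₁ hs₂).trans ?_
      have ht := transfer_eigenFun_le (x := q' / q) (by rw [le_div_iff₀ hq]; linarith)
        (by rw [div_le_iff₀ hq]; linarith)
      have e : ∀ {d : ℝ}, 0 < d → (d * q + q') ^ (-(thetaE2 : ℝ)) * eigenFun (q / (d * q + q')) =
          q ^ (-(thetaE2 : ℝ)) * ((d + q' / q) ^ (-(thetaE2 : ℝ)) *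
            eigenFun (1 / (d + q' / q))) := by
        intro d hd
        have e1 : d * q + q' = q * (d + q' / q) := by field_simp
        have e2 : q / (d * q + q') = 1 / (d + q' / q) := by field_simp
        rw [e2, e1, Real.mul_rpow hq.le (by positivity), mul_assoc]
      rw [e one_pos, e two_pos, ← mul_add, ← mul_add]
      gcongr

lemma hausdorffMeasure_mob_image_E2_lt_top {p p' q q' : ℝ} (hdet : |p * q' - p' * q| = 1)
    (hq : 0 < q) (h1 : q ≤ 3 * q') (h2 : 4 * q' ≤ 3 * q) :
    MeasureTheory.Measure.hausdorffMeasure ((thetaE2 : ℝ) / 2) ((mob p p' q q') '' E2) < ⊤ := by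
  have hθ : (0 : ℝ) ≤ (thetaE2 : ℝ) / 2 := by norm_num [thetaE2]
  refine (hausdorffMeasure_le_of_covers hθ
    (C := ENNReal.ofReal (2 * (q ^ (-(thetaE2 : ℝ)) * eigenFun (q' / q))))
    (δ := fun n => ENNReal.ofReal ((9 / 16) ^ n / q ^ 2)) ?_ fun n => ?_).trans_lt
    ENNReal.ofReal_lt_top
  · rw [← ENNReal.ofReal_zero]
    refine ENNReal.tendsto_ofReal ?_
    rw [← zero_div (q ^ 2)]
    exact (tendsto_pow_atTop_nhds_zero_of_lt_one (by norm_num) (by norm_num)).div_const _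
  · obtain ⟨ι, _, t, w, hw, hc, hs⟩ := exists_cover_mob_image_E2 n hdet hq h1 h2
    refine ⟨ι, inferInstance, t, fun i => ENNReal.ofReal (w i),
      fun i => ⟨ENNReal.ofReal_le_ofReal (hw i).2.1, (hw i).2.2⟩, hc, ?_⟩
    rw [tsum_fintype]
    refine le_trans (le_of_eq ?_) (ENNReal.ofReal_le_ofReal hs)
    rw [ENNReal.ofReal_sum_of_nonneg fun i _ => Real.rpow_nonneg (hw i).1 _]
    exact Finset.sum_congr rfl fun i _ => ENNReal.ofReal_rpow_of_nonneg (hw i).1 hθ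

lemma hausdorffMeasure_E2_lt_top :
    MeasureTheory.Measure.hausdorffMeasure ((thetaE2 : ℝ) / 2) E2 < ⊤ := by
  have hsplit : ∀ {p p' q q' : ℝ},
      MeasureTheory.Measure.hausdorffMeasure ((thetaE2 : ℝ) / 2)
        (mob (1 * p + p') p (1 * q + q') q '' E2) < ⊤ →
      MeasureTheory.Measure.hausdorffMeasure ((thetaE2 : ℝ) / 2)
        (mob (2 * p + p') p (2 * q + q') q '' E2) < ⊤ →
      MeasureTheory.Measure.hausdorffMeasure ((thetaE2 : ℝ) / 2) ((mob p p' q q') '' E2) < ⊤ :=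
    fun h1 h2 => (MeasureTheory.measure_mono mob_image_E2_subset).trans_lt
      (MeasureTheory.measure_union_lt_top h1 h2)
  have e : E2 = mob 0 1 1 0 '' E2 := by
    have : mob 0 1 1 0 = id := by funext x; simp [mob]
    rw [this, Set.image_id]
  rw [e]
  refine hsplit (hsplit ?_ ?_) (hsplit ?_ ?_) <;>
  exact hausdorffMeasure_mob_image_E2_lt_top (by norm_num) (by norm_num) (by norm_num)
    (by norm_num)

lemma dimH_E2_lt : dimH E2 < ENNReal.ofReal 0.531281 := by
  have h := dimH_le_of_hausdorffMeasure_ne_top (s := E2) (d := ((thetaE2 : ℚ) / 2 : ℝ).toNNReal)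
    (by rw [Real.coe_toNNReal _ (by norm_num [thetaE2])]; exact hausdorffMeasure_E2_lt_top.ne)
  refine h.trans_lt ?_
  change ENNReal.ofReal _ < _
  rw [ENNReal.ofReal_lt_ofReal_iff (by norm_num)]
  norm_num [thetaE2]

/-! ### Sets of digit sequences with forced continuations at branchings -/

/-- A set of sequences over `{1, 2}` in which two members that branch after a common prefix must
continue as `1 1 2` and `2 2 1`. -/
def BranchForced (T : Set (ℕ → ℕ)) : Prop :=
  (∀ a ∈ T, ∀ n, a n = 1 ∨ a n = 2) ∧
    ∀ a ∈ T, ∀ b ∈ T, ∀ n, (∀ i < n, a i = b i) → a n = 1 → b n = 2 →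
      (a (n + 1) = 1 ∧ a (n + 2) = 2) ∧ (b (n + 1) = 2 ∧ b (n + 2) = 1)

/-- Drop the first digit of every sequence in `T`. -/
def tails (T : Set (ℕ → ℕ)) : Set (ℕ → ℕ) := (fun a k => a (k + 1)) '' T

lemma BranchForced.mono {S T : Set (ℕ → ℕ)} (hT : BranchForced T) (h : S ⊆ T) :
    BranchForced S :=
  ⟨fun a ha => hT.1 a (h ha), fun a ha b hb => hT.2 a (h ha) b (h hb)⟩

lemma BranchForced.tails {T : Set (ℕ → ℕ)} (hT : BranchForced T) {d : ℕ}
    (h : ∀ a ∈ T, a 0 = d) : BranchForced (tails T) := by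
  constructor
  · rintro _ ⟨a, ha, rfl⟩ n
    exact hT.1 a ha _
  · rintro _ ⟨a, ha, rfl⟩ _ ⟨b, hb, rfl⟩ n hab h1 h2
    refine hT.2 a ha b hb (n + 1) (fun i hi => ?_) h1 h2
    cases i with
    | zero => rw [h a ha, h b hb]
    | succ i => exact hab i (by omega)

lemma BranchForced.one_le {T : Set (ℕ → ℕ)} (hT : BranchForced T) {a : ℕ → ℕ} (ha : a ∈ T)
    (n : ℕ) : 1 ≤ a n := by
  rcases hT.1 a ha n with h | h <;> omega

lemma BranchForced.cf01_image_subset {T : Set (ℕ → ℕ)} (hT : BranchForced T) :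
    cf01 '' T ⊆ Set.Icc 0 1 := by
  rintro _ ⟨a, ha, rfl⟩
  exact ⟨(cf01_pos (hT.one_le ha)).le, cf01_le_one (hT.one_le ha)⟩

lemma BranchForced.mob_image_subset {T : Set (ℕ → ℕ)} (hT : BranchForced T) {d : ℕ}
    (h : ∀ a ∈ T, a 0 = d) (p p' q q' : ℝ) :
    (mob p p' q q') '' (cf01 '' T) ⊆
      mob (d * p + p') p (d * q + q') q '' (cf01 '' _root_.tails T) := by
  rintro _ ⟨_, ⟨a, ha, rfl⟩, rfl⟩
  refine ⟨_, ⟨_, ⟨a, ha, rfl⟩, rfl⟩, ?_⟩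
  have h1 := cf01_pos (a := fun k => a (k + 1)) fun n => hT.one_le ha (n + 1)
  rw [cf01_eq (hT.one_le ha), h a ha]
  exact (mob_one_div (by positivity)).symm

lemma branch_ratio_le {q q' : ℝ} (hq : 0 < q) (hq' : 0 ≤ q') :
    (q * (q + q') / ((5 * q + 3 * q') * (7 * q + 4 * q'))) ^ (18 / 103 : ℝ) +
      (q * (q + q') / ((7 * q + 3 * q') * (12 * q + 5 * q'))) ^ (18 / 103 : ℝ) ≤ 1 := by
  have key : ∀ {x y c : ℝ}, 0 ≤ x → x ≤ y → 0 ≤ c → y ^ 18 ≤ c ^ 103 → x ^ (18 / 103 : ℝ) ≤ c := by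
    intro x y c hx hxy hc h
    have h2 : x ^ (18 : ℕ) ≤ c ^ (103 : ℕ) := (pow_le_pow_left₀ hx hxy 18).trans h
    have h3 := Real.rpow_le_rpow (by positivity) h2 (by norm_num : (0 : ℝ) ≤ 1 / 103)
    rw [← Real.rpow_natCast, ← Real.rpow_natCast, ← Real.rpow_mul hx, ← Real.rpow_mul hc] at h3
    norm_num at h3
    exact h3
  have hA : 0 ≤ q * (q + q') / ((5 * q + 3 * q') * (7 * q + 4 * q')) := by positivity
  have hB : 0 ≤ q * (q + q') / ((7 * q + 3 * q') * (12 * q + 5 * q')) := by positivity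
  have hA0 : 0 < (5 * q + 3 * q') * (7 * q + 4 * q') := by positivity
  have hB0 : 0 < (7 * q + 3 * q') * (12 * q + 5 * q') := by positivity
  rcases le_total (20 * q') q with h | h
  · have h1 := key (y := 1 / 35) (c := 0.53725) hA (by
      rw [div_le_div_iff₀ hA0 (by norm_num)]; nlinarith) (by norm_num) (by norm_num)
    have h2 := key (y := 10 / 833) (c := 0.46175) hB (by
      rw [div_le_div_iff₀ hB0 (by norm_num)]; nlinarith) (by norm_num) (by norm_num)
    linarith
  · have h1 := key (y := 10 / 353) (c := 0.5366) hA (by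
      rw [div_le_div_iff₀ hA0 (by norm_num)]; nlinarith) (by norm_num) (by norm_num)
    have h2 := key (y := 10 / 819) (c := 0.4633) hB (by
      rw [div_le_div_iff₀ hB0 (by norm_num)]
      nlinarith [sq_nonneg (q' - 0.37 * q)]) (by norm_num) (by norm_num)
    linarith

lemma BranchForced.exists_cover_mob_image (n : ℕ) : ∀ {T : Set (ℕ → ℕ)}, BranchForced T →
    ∀ {p p' q q' ρ : ℝ}, |p * q' - p' * q| = 1 → 0 < q → 0 ≤ q' → q' ≤ q → 0 < ρ →
    1 / (q * (q + q')) ≤ 2 ^ n * ρ → ρ ≤ 100 / (q * (q + q')) →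
    ∃ (ι : Type) (_ : Fintype ι) (t : ι → Set ℝ),
      (∀ i, Metric.ediam (t i) ≤ ENNReal.ofReal ρ) ∧ (mob p p' q q') '' (cf01 '' T) ⊆ ⋃ i, t i ∧
      (Fintype.card ι : ℝ) ≤ (100 / (q * (q + q')) / ρ) ^ (18 / 103 : ℝ) := by
  induction n with
  | zero =>
    intro T hT p p' q q' ρ hdet hq hq' _ hρ h1 h2
    refine ⟨Unit, inferInstance, fun _ => (mob p p' q q') '' (cf01 '' T), fun _ => ?_,
      fun x hx => Set.mem_iUnion.2 ⟨(), hx⟩, ?_⟩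
    · refine (ediam_mob_image_le hdet hq hq' hT.cf01_image_subset).trans
        (ENNReal.ofReal_le_ofReal (by simpa using h1))
    · simpa using Real.one_le_rpow ((one_le_div hρ).2 h2) (by norm_num)
  | succ n ih =>
    intro T hT p p' q q' ρ hdet hq hq' hqq hρ h1 h2
    rcases le_or_gt (1 / (q * (q + q'))) ρ with hs | hs
    · refine ⟨Unit, inferInstance, fun _ => (mob p p' q q') '' (cf01 '' T), fun _ => ?_,
        fun x hx => Set.mem_iUnion.2 ⟨(), hx⟩, ?_⟩
      · exact (ediam_mob_image_le hdet hq hq' hT.cf01_image_subset).trans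
          (ENNReal.ofReal_le_ofReal hs)
      · simpa using Real.one_le_rpow ((one_le_div hρ).2 h2) (by norm_num)
    have hQ : 0 < q * (q + q') := by positivity
    have hs' : ρ * (q * (q + q')) < 1 := by rwa [lt_div_iff₀ hQ] at hs
    -- sizes after prescribed digits
    have hsize : ∀ {D : ℝ}, 2 * (q * (q + q')) ≤ D → D ≤ 100 * (q * (q + q')) →
        1 / D ≤ 2 ^ n * ρ ∧ ρ ≤ 100 / D := by
      intro D hD hD'
      have hD0 : 0 < D := by linarith
      constructor
      · rw [div_le_iff₀ hD0]
        rw [div_le_iff₀ hQ, pow_succ] at h1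
        have : 0 < 2 ^ n * ρ := by positivity
        nlinarith
      · rw [le_div_iff₀ hD0]
        nlinarith
    have single : ∀ d : ℕ, 1 ≤ d → d ≤ 2 → (∀ a ∈ T, a 0 = d) →
        ∃ (ι : Type) (_ : Fintype ι) (t : ι → Set ℝ),
        (∀ i, Metric.ediam (t i) ≤ ENNReal.ofReal ρ) ∧ (mob p p' q q') '' (cf01 '' T) ⊆ ⋃ i, t i ∧
        (Fintype.card ι : ℝ) ≤ (100 / (q * (q + q')) / ρ) ^ (18 / 103 : ℝ) := by
      intro d hd hd' hT0
      have hd1 : (1 : ℝ) ≤ d := by exact_mod_cast hd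
      have hd2 : (d : ℝ) ≤ 2 := by exact_mod_cast hd'
      have hd3 : q ≤ d * q := by nlinarith
      have hd4 : d * q ≤ 2 * q := by nlinarith
      have hD : 2 * (q * (q + q')) ≤ (d * q + q') * (d * q + q' + q) := by
        nlinarith [mul_le_mul (add_le_add_left hd3 q') (add_le_add_left (add_le_add_left hd3 q') q)
          (by positivity) (by positivity)]
      have hD' : (d * q + q') * (d * q + q' + q) ≤ 100 * (q * (q + q')) := by
        nlinarith [mul_le_mul (add_le_add_left hd4 q') (add_le_add_left (add_le_add_left hd4 q') q)
          (by positivity) (by positivity)]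
      obtain ⟨h3, h4⟩ := hsize hD hD'
      obtain ⟨ι, _, t, ht, hc, hcard⟩ := ih (hT.tails hT0) (abs_det_step d hdet)
        (by positivity) hq.le (by linarith) hρ h3 h4
      refine ⟨ι, inferInstance, t, ht, (hT.mob_image_subset hT0 p p' q q').trans hc,
        hcard.trans ?_⟩
      have : 100 / ((d * q + q') * (d * q + q' + q)) ≤ 100 / (q * (q + q')) :=
        div_le_div_of_nonneg_left (by norm_num) hQ (by linarith)
      gcongr
    by_cases c1 : ∀ a ∈ T, a 0 = 1
    · exact single 1 le_rfl (by norm_num) c1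
    by_cases c2 : ∀ a ∈ T, a 0 = 2
    · exact single 2 (by norm_num) le_rfl c2
    push Not at c1 c2
    obtain ⟨b, hb, hb1⟩ := c1
    obtain ⟨a, ha, ha1⟩ := c2
    have hb2 := (hT.1 b hb 0).resolve_left hb1
    have ha2 := (hT.1 a ha 0).resolve_right ha1
    have triple : ∀ d₀ d₁ d₂ : ℕ, ∀ Q Q' : ℝ, Q = d₂ * (d₁ * (d₀ * q + q') + q) + (d₀ * q + q') →
        Q' = d₁ * (d₀ * q + q') + q → 0 < Q → 0 ≤ Q' → Q' ≤ Q →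
        2 * (q * (q + q')) ≤ Q * (Q + Q') → Q * (Q + Q') ≤ 100 * (q * (q + q')) →
        (∀ a ∈ T, a 0 = d₀ → a 1 = d₁ ∧ a 2 = d₂) →
        ∃ (ι : Type) (_ : Fintype ι) (t : ι → Set ℝ),
        (∀ i, Metric.ediam (t i) ≤ ENNReal.ofReal ρ) ∧
        (mob p p' q q') '' (cf01 '' {a ∈ T | a 0 = d₀}) ⊆ ⋃ i, t i ∧
        (Fintype.card ι : ℝ) ≤ (100 / (q * (q + q')) / ρ) ^ (18 / 103 : ℝ) *
          (q * (q + q') / (Q * (Q + Q'))) ^ (18 / 103 : ℝ) := by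
      rintro d₀ d₁ d₂ Q Q' rfl rfl hQ0 hQ1 hQ2 hQ3 hQ4 hT3
      have hS : BranchForced {a ∈ T | a 0 = d₀} := hT.mono fun a ha => ha.1
      have k0 : ∀ a ∈ {a ∈ T | a 0 = d₀}, a 0 = d₀ := fun a ha => ha.2
      have k1 : ∀ a ∈ _root_.tails {a ∈ T | a 0 = d₀}, a 0 = d₁ := by
        rintro _ ⟨a, ha, rfl⟩; exact (hT3 a ha.1 ha.2).1
      have k2 : ∀ a ∈ _root_.tails (_root_.tails {a ∈ T | a 0 = d₀}), a 0 = d₂ := by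
        rintro _ ⟨_, ⟨a, ha, rfl⟩, rfl⟩; exact (hT3 a ha.1 ha.2).2
      have m0 := hS.mob_image_subset k0 p p' q q'
      have m1 := (hS.tails k0).mob_image_subset k1 (d₀ * p + p') p (d₀ * q + q') q
      have m2 := ((hS.tails k0).tails k1).mob_image_subset k2 (d₁ * (d₀ * p + p') + p)
        (d₀ * p + p') (d₁ * (d₀ * q + q') + q) (d₀ * q + q')
      obtain ⟨h3, h4⟩ := hsize hQ3 hQ4
      obtain ⟨ι, _, t, ht, hc, hcard⟩ := ih (((hS.tails k0).tails k1).tails k2)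
        (abs_det_step d₂ (abs_det_step d₁ (abs_det_step d₀ hdet))) hQ0 hQ1 hQ2 hρ h3 h4
      refine ⟨ι, inferInstance, t, ht, (m0.trans (m1.trans m2)).trans hc, hcard.trans_eq ?_⟩
      rw [← Real.mul_rpow (by positivity) (by positivity)]
      congr 1
      field_simp
    have hq3 : q * q' ≤ q * q := mul_le_mul_of_nonneg_left hqq hq.le
    have hq4 : q' * q' ≤ q * q' := mul_le_mul_of_nonneg_right hqq hq'
    have hq5 : 0 ≤ q' * q' := by positivity
    have hq6 : 0 ≤ q * q' := by positivity
    obtain ⟨ι₁, _, t₁, ht₁, hc₁, hn₁⟩ := triple 1 1 2 (5 * q + 3 * q') (2 * q + q')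
      (by push_cast; ring) (by push_cast; ring) (by positivity) (by positivity) (by linarith)
      (by nlinarith) (by nlinarith)
      (fun x hx hx0 => (hT.2 x hx b hb 0 (by simp) hx0 hb2).1)
    obtain ⟨ι₂, _, t₂, ht₂, hc₂, hn₂⟩ := triple 2 2 1 (7 * q + 3 * q') (5 * q + 2 * q')
      (by push_cast; ring) (by push_cast; ring) (by positivity) (by positivity) (by linarith)
      (by nlinarith) (by nlinarith)
      (fun x hx hx0 => (hT.2 a ha x hx 0 (by simp) ha2 hx0).2)
    refine ⟨ι₁ ⊕ ι₂, inferInstance, Sum.elim t₁ t₂, ?_, ?_, ?_⟩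
    · rintro (i | i)
      · exact ht₁ i
      · exact ht₂ i
    · rw [Set.iUnion_sum]
      rintro _ ⟨_, ⟨x, hx, rfl⟩, rfl⟩
      rcases hT.1 x hx 0 with h | h
      · exact Or.inl (hc₁ ⟨_, ⟨x, ⟨hx, h⟩, rfl⟩, rfl⟩)
      · exact Or.inr (hc₂ ⟨_, ⟨x, ⟨hx, h⟩, rfl⟩, rfl⟩)
    · rw [Fintype.card_sum, Nat.cast_add]
      refine (add_le_add hn₁ hn₂).trans ?_
      rw [← mul_add]
      refine mul_le_of_le_one_right (by positivity) ?_
      rw [show 5 * q + 3 * q' + (2 * q + q') = 7 * q + 4 * q' by ring,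
        show 7 * q + 3 * q' + (5 * q + 2 * q') = 12 * q + 5 * q' by ring]
      exact branch_ratio_le hq hq'

lemma BranchForced.exists_cover {T : Set (ℕ → ℕ)} (hT : BranchForced T) {ρ : ℝ} (hρ : 0 < ρ)
    (hρ1 : ρ ≤ 1) : ∃ (ι : Type) (_ : Fintype ι) (t : ι → Set ℝ),
      (∀ i, Metric.ediam (t i) ≤ ENNReal.ofReal ρ) ∧ cf01 '' T ⊆ ⋃ i, t i ∧
      (Fintype.card ι : ℝ) ≤ (100 / ρ) ^ (18 / 103 : ℝ) := by
  obtain ⟨n, hn⟩ := pow_unbounded_of_one_lt (1 / ρ) (one_lt_two)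
  obtain ⟨ι, _, t, h1, h2, h3⟩ := hT.exists_cover_mob_image n (p := 0) (p' := 1) (q := 1)
    (q' := 0) (ρ := ρ) (by norm_num) one_pos le_rfl zero_le_one hρ
    (by rw [div_lt_iff₀ hρ] at hn; simpa using hn.le) (by norm_num; linarith)
  have e : mob 0 1 1 0 = id := by funext x; simp [mob]
  rw [e, Set.image_id] at h2
  exact ⟨ι, inferInstance, t, h1, h2, by simpa using h3⟩

/-! ### Dimension of sumsets -/

lemma exists_cover_of_hausdorffMeasure_eq_zero {F : Set ℝ} {t : ℝ} (ht : 0 < t)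
    (hF : MeasureTheory.Measure.hausdorffMeasure t F = 0) {κ : ℝ} (hκ : 0 < κ) :
    ∃ (U : ℕ → Set ℝ) (ρ : ℕ → ℝ), F ⊆ ⋃ i, U i ∧
      (∀ i, 0 < ρ i ∧ ρ i ≤ κ ∧ Metric.ediam (U i) ≤ ENNReal.ofReal (ρ i)) ∧
      ∑' i, ENNReal.ofReal (ρ i) ^ t ≤ ENNReal.ofReal κ ^ t := by
  set K : ENNReal := ENNReal.ofReal κ ^ t with hK
  have hK0 : K ≠ 0 := by
    rw [hK]; simp [ENNReal.rpow_eq_zero_iff, hκ, ht]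
  have hKt : K ≠ ⊤ := ENNReal.rpow_ne_top_of_nonneg ht.le ENNReal.ofReal_ne_top
  have hK2 : K / 2 ≠ 0 := (ENNReal.half_pos hK0).ne'
  rw [MeasureTheory.Measure.hausdorffMeasure_apply] at hF
  have h1 := (iSup₂_eq_bot.1 hF) 1 one_pos
  obtain ⟨U, hU⟩ := iInf_lt_iff.1 (h1.trans_lt (pos_iff_ne_zero.2 hK2))
  obtain ⟨hFU, hU⟩ := iInf_lt_iff.1 hU
  obtain ⟨-, hU⟩ := iInf_lt_iff.1 hU
  have e : ∀ n, (⨆ _ : (U n).Nonempty, Metric.ediam (U n) ^ t) = Metric.ediam (U n) ^ t := by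
    intro n
    rcases (U n).eq_empty_or_nonempty with h | h
    · simp [h, ht]
    · simp [h]
  simp_rw [e] at hU
  obtain ⟨ε, hε, hεs⟩ := ENNReal.exists_pos_sum_of_countable' hK2 ℕ
  have hsum : ∑' i, (Metric.ediam (U i) ^ t + ε i) ≤ K := by
    rw [ENNReal.tsum_add]
    exact (add_le_add hU.le hεs.le).trans_eq (ENNReal.add_halves K)
  have hle : ∀ i, Metric.ediam (U i) ^ t + ε i ≤ K := fun i => (ENNReal.le_tsum i).trans hsum
  set r : ℕ → ENNReal := fun i => (Metric.ediam (U i) ^ t + ε i) ^ (1 / t) with hr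
  have hrt : ∀ i, r i ^ t = Metric.ediam (U i) ^ t + ε i := fun i => by
    rw [hr]; simp only; rw [← ENNReal.rpow_mul, one_div_mul_cancel ht.ne', ENNReal.rpow_one]
  have hrκ : ∀ i, r i ≤ ENNReal.ofReal κ := fun i => by
    rw [← ENNReal.rpow_le_rpow_iff ht, hrt]; exact hle i
  have hr0 : ∀ i, r i ≠ 0 := fun i h => by
    have := hrt i
    rw [h, ENNReal.zero_rpow_of_pos ht] at this
    exact (hε i).ne' (add_eq_zero.1 this.symm).2
  have hrtop : ∀ i, r i ≠ ⊤ := fun i => ne_top_of_le_ne_top ENNReal.ofReal_ne_top (hrκ i)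
  refine ⟨U, fun i => (r i).toReal, hFU, fun i => ⟨ENNReal.toReal_pos (hr0 i) (hrtop i),
    ENNReal.toReal_le_of_le_ofReal hκ.le (hrκ i), ?_⟩, ?_⟩
  · rw [ENNReal.ofReal_toReal (hrtop i), ← ENNReal.rpow_le_rpow_iff ht, hrt]
    exact le_self_add
  · simp_rw [ENNReal.ofReal_toReal (hrtop _), hrt]
    exact hsum

lemma ediam_image2_add_le (A B : Set ℝ) :
    Metric.ediam (Set.image2 (· + ·) A B) ≤ Metric.ediam A + Metric.ediam B := by
  refine Metric.ediam_le ?_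
  rintro _ ⟨a, ha, b, hb, rfl⟩ _ ⟨a', ha', b', hb', rfl⟩
  exact (edist_add_add_le a b a' b').trans
    (add_le_add (Metric.edist_le_ediam_of_mem ha ha') (Metric.edist_le_ediam_of_mem hb hb'))

lemma hausdorffMeasure_image2_add_lt_top {K F : Set ℝ} {s t C : ℝ} (hs : 0 ≤ s) (ht : 0 < t)
    (hC : 0 < C)
    (hK : ∀ ρ : ℝ, 0 < ρ → ρ ≤ 1 → ∃ (ι : Type) (_ : Fintype ι) (u : ι → Set ℝ),
      (∀ i, Metric.ediam (u i) ≤ ENNReal.ofReal ρ) ∧ K ⊆ ⋃ i, u i ∧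
      (Fintype.card ι : ℝ) ≤ (C / ρ) ^ s)
    (hF : MeasureTheory.Measure.hausdorffMeasure t F = 0) :
    MeasureTheory.Measure.hausdorffMeasure (s + t) (Set.image2 (· + ·) K F) < ⊤ := by
  have hst : 0 ≤ s + t := by positivity
  refine (hausdorffMeasure_le_of_covers hst (C := ENNReal.ofReal (C ^ s * 2 ^ (s + t)))
    (δ := fun n : ℕ => ENNReal.ofReal (2 * (1 / (n + 1)))) ?_ fun n => ?_).trans_lt
    ENNReal.ofReal_lt_top
  · rw [← ENNReal.ofReal_zero]
    refine ENNReal.tendsto_ofReal ?_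
    simpa using (tendsto_one_div_add_atTop_nhds_zero_nat (𝕜 := ℝ)).const_mul 2
  have hn1 : (1 : ℝ) / (n + 1) ≤ 1 := by
    rw [div_le_one (by positivity)]; linarith [(Nat.cast_nonneg n : (0 : ℝ) ≤ n)]
  obtain ⟨U, ρ, hFU, hρ, hsum⟩ := exists_cover_of_hausdorffMeasure_eq_zero ht hF
    (κ := 1 / (n + 1)) (by positivity)
  choose ι hι u hu hKu hcard using fun i => hK (ρ i) (hρ i).1 ((hρ i).2.1.trans hn1)
  refine ⟨Σ i, ι i, inferInstance, fun x => Set.image2 (· + ·) (u x.1 x.2) (U x.1),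
    fun x => ENNReal.ofReal (2 * ρ x.1), fun x => ⟨?_, ?_⟩, ?_, ?_⟩
  · exact ENNReal.ofReal_le_ofReal (by linarith [(hρ x.1).2.1])
  · refine (ediam_image2_add_le _ _).trans ?_
    simp only
    rw [two_mul, ENNReal.ofReal_add (hρ x.1).1.le (hρ x.1).1.le]
    exact add_le_add (hu _ _) (hρ _).2.2
  · rintro _ ⟨x, hx, y, hy, rfl⟩
    obtain ⟨i, hi⟩ := Set.mem_iUnion.1 (hFU hy)
    obtain ⟨j, hj⟩ := Set.mem_iUnion.1 (hKu i hx)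
    exact Set.mem_iUnion.2 ⟨⟨i, j⟩, x, hj, y, hi, rfl⟩
  · rw [ENNReal.tsum_sigma']
    have hi : ∀ i, ∑' _ : ι i, ENNReal.ofReal (2 * ρ i) ^ (s + t) ≤
        ENNReal.ofReal (C ^ s * 2 ^ (s + t)) * ENNReal.ofReal (ρ i) ^ t := by
      intro i
      have h0 := (hρ i).1
      rw [tsum_fintype, Finset.sum_const, Finset.card_univ, nsmul_eq_mul,
        ENNReal.ofReal_rpow_of_pos (by positivity), ENNReal.ofReal_rpow_of_pos h0,
        ← ENNReal.ofReal_natCast, ← ENNReal.ofReal_mul (by positivity),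
        ← ENNReal.ofReal_mul (by positivity)]
      refine ENNReal.ofReal_le_ofReal
        ((mul_le_mul_of_nonneg_right (hcard i) (by positivity)).trans_eq ?_)
      rw [Real.div_rpow hC.le h0.le, Real.mul_rpow two_pos.le h0.le, Real.rpow_add h0]
      have : 0 < ρ i ^ s := by positivity
      field_simp
    refine (ENNReal.tsum_le_tsum hi).trans ?_
    rw [ENNReal.tsum_mul_left]
    refine mul_le_of_le_one_right' (hsum.trans ?_)
    exact ENNReal.rpow_le_one (by simpa using hn1) ht.le

lemma dimH_image2_add_le {K F : Set ℝ} {s : NNReal} {C : ℝ} (hC : 0 < C)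
    (hK : ∀ ρ : ℝ, 0 < ρ → ρ ≤ 1 → ∃ (ι : Type) (_ : Fintype ι) (u : ι → Set ℝ),
      (∀ i, Metric.ediam (u i) ≤ ENNReal.ofReal ρ) ∧ K ⊆ ⋃ i, u i ∧
      (Fintype.card ι : ℝ) ≤ (C / ρ) ^ (s : ℝ)) :
    dimH (Set.image2 (· + ·) K F) ≤ s + dimH F := by
  refine ENNReal.le_of_forall_pos_le_add fun ε hε hlt => ?_
  have hF : dimH F ≠ ⊤ := fun h => by simp [h] at hlt
  lift dimH F to NNReal using hF with d hd
  have h0 : MeasureTheory.Measure.hausdorffMeasure ((d + ε : NNReal) : ℝ) F = 0 := by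
    refine hausdorffMeasure_of_dimH_lt ?_
    rw [← hd]
    exact_mod_cast lt_add_of_pos_right d hε
  have h := hausdorffMeasure_image2_add_lt_top s.2 (t := (d + ε : NNReal)) (by positivity) hC hK h0
  refine (dimH_le_of_hausdorffMeasure_ne_top (d := s + (d + ε))
    (by push_cast at h ⊢; exact h.ne)).trans ?_
  push_cast
  rw [add_assoc]

/-! ### The local values `λ₀(σⁿ α)` -/

/-- `λ₀(σⁿ α)` written as a digit plus two continued fractions in `[0, 1]`. -/
noncomputable def lam (α : ℤ → ℕ) (n : ℤ) : ℝ :=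
  α n + cf01 (fun k : ℕ => α (n + 1 + k)) + cf01 (fun k : ℕ => α (n - 1 - k))

lemma lambda0_shiftZ {α : ℤ → ℕ} (hα : ∀ i, 1 ≤ α i) (n : ℤ) :
    lambda0 (shiftZ n α) = lam α n := by
  rw [lambda0, cfVal_eq (a := fun k : ℕ => shiftZ n α k) fun k => hα _, lam]
  simp only [shiftZ]
  congr 3
  · simp
  · funext k; congr 1; push_cast; ring
  · funext k; congr 1; ring

lemma lam_comp_add (α : ℤ → ℕ) (c n : ℤ) : lam (fun i => α (i + c)) n = lam α (n + c) := by
  simp only [lam]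
  congr 3
  · funext k; congr 1; ring
  · funext k; congr 1; ring

lemma lam_comp_neg (α : ℤ → ℕ) (n : ℤ) : lam (fun i => α (-i)) n = lam α (-n) := by
  simp only [lam]
  rw [add_assoc, add_assoc, add_comm (cf01 _)]
  congr 3
  · funext k; congr 1; ring
  · funext k; congr 1; ring

lemma abs_lam_sub_le {α β : ℤ → ℕ} (hα : ∀ i, 1 ≤ α i) (hβ : ∀ i, 1 ≤ β i) (j : ℕ) {n : ℤ}
    (h : ∀ i, n - 2 * j ≤ i → i ≤ n + 2 * j → α i = β i) :
    |lam α n - lam β n| ≤ 2 * (1 / 4) ^ j := by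
  have h1 := abs_cf01_sub_le j (a := fun k : ℕ => α (n + 1 + k)) (b := fun k : ℕ => β (n + 1 + k))
    (fun _ => hα _) (fun _ => hβ _) (fun i hi => h _ (by omega) (by omega))
  have h2 := abs_cf01_sub_le j (a := fun k : ℕ => α (n - 1 - k)) (b := fun k : ℕ => β (n - 1 - k))
    (fun _ => hα _) (fun _ => hβ _) (fun i hi => h _ (by omega) (by omega))
  rw [lam, lam, h n (by omega) (by omega)]
  rw [abs_le] at *
  constructor <;> linarith

lemma tendsto_lam {β : ℕ → ℤ → ℕ} {α : ℤ → ℕ} (hα : ∀ i, 1 ≤ α i) (hβ : ∀ k i, 1 ≤ β k i)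
    (h : ∀ i, ∀ᶠ k in atTop, β k i = α i) (n : ℤ) :
    Tendsto (fun k => lam (β k) n) atTop (nhds (lam α n)) := by
  rw [Metric.tendsto_atTop']
  intro ε hε
  obtain ⟨j, hj⟩ := exists_pow_lt_of_lt_one (half_pos hε) (by norm_num : (1 / 4 : ℝ) < 1)
  have hev : ∀ᶠ k in atTop, ∀ i ∈ Finset.Icc (n - 2 * j) (n + 2 * j), β k i = α i :=
    (Finset.eventually_all _).2 fun i _ => h i
  obtain ⟨N, hN⟩ := eventually_atTop.1 hev
  refine ⟨N, fun k hk => ?_⟩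
  have := abs_lam_sub_le (hβ k) hα j (n := n)
    (fun i h1 h2 => hN k hk.le i (Finset.mem_Icc.2 ⟨h1, h2⟩))
  rw [Real.dist_eq]
  linarith

/-! ### Elements of the Markov spectrum below `√13` -/

lemma cf01_mem_of_le_three {a : ℕ → ℕ} (h1 : ∀ n, 1 ≤ a n) (h3 : ∀ n, a n ≤ 3) :
    1 / 3.8 ≤ cf01 a ∧ cf01 a ≤ 0.8 := by
  have key : ∀ {a : ℕ → ℕ}, (∀ n, 1 ≤ a n) → (∀ n, a n ≤ 3) → 1 / 4 ≤ cf01 a ∧ cf01 a ≤ 1 := by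
    intro a h1 h3
    refine ⟨?_, cf01_le_one h1⟩
    have h0 : (a 0 : ℝ) ≤ 3 := by exact_mod_cast h3 0
    have := cf01_le_one (a := fun k => a (k + 1)) fun n => h1 _
    have := cf01_pos (a := fun k => a (k + 1)) fun n => h1 _
    rw [cf01_eq h1]
    exact one_div_le_one_div_of_le (by positivity) (by linarith)
  have key2 : ∀ {a : ℕ → ℕ}, (∀ n, 1 ≤ a n) → (∀ n, a n ≤ 3) → cf01 a ≤ 0.8 := by
    intro a h1 h3
    have h0 : (1 : ℝ) ≤ a 0 := by exact_mod_cast h1 0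
    have := key (a := fun k => a (k + 1)) (fun n => h1 _) (fun n => h3 _)
    rw [cf01_eq h1, div_le_iff₀ (by linarith)]
    linarith
  refine ⟨?_, key2 h1 h3⟩
  have h0 : (a 0 : ℝ) ≤ 3 := by exact_mod_cast h3 0
  have := key2 (a := fun k => a (k + 1)) (fun n => h1 _) (fun n => h3 _)
  have := cf01_pos (a := fun k => a (k + 1)) fun n => h1 _
  rw [cf01_eq h1]
  exact one_div_le_one_div_of_le (by positivity) (by linarith)

lemma sqrt_thirteen_lt : Real.sqrt 13 < 3.606 := by
  rw [Real.sqrt_lt' (by norm_num)]; norm_num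

lemma cf01_const_three : 3 + cf01 (fun _ => 3) + cf01 (fun _ => 3) = Real.sqrt 13 := by
  have h := cf01_eq (a := fun _ => 3) (fun _ => by norm_num)
  have h0 := cf01_pos (a := fun _ => 3) (fun _ => by norm_num)
  set c := cf01 fun _ => 3
  rw [eq_div_iff (by positivity)] at h
  push_cast at h
  rw [eq_comm, Real.sqrt_eq_iff_mul_self_eq (by norm_num) (by positivity)]
  nlinarith

/-- Next to a digit `3` there is another `3`, on the side of the first continued fraction. -/
lemma eq_three_of_add_lt {a b : ℕ → ℕ} (ha1 : ∀ n, 1 ≤ a n) (ha3 : ∀ n, a n ≤ 3)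
    (hb1 : ∀ n, 1 ≤ b n) (hb3 : ∀ n, b n ≤ 3) (h : 3 + cf01 a + cf01 b < Real.sqrt 13) :
    a 0 = 3 := by
  by_contra hne
  have ha0 : (a 0 : ℝ) ≤ 2 := by
    have := ha3 0
    exact_mod_cast (by omega : a 0 ≤ 2)
  have h1 := cf01_mem_of_le_three (a := fun k => a (k + 1)) (fun n => ha1 _) (fun n => ha3 _)
  have h2 := cf01_mem_of_le_three hb1 hb3
  have h3 : 1 / 2.8 ≤ cf01 a := by
    rw [cf01_eq ha1]
    refine one_div_le_one_div_of_le ?_ (by linarith [h1.2])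
    have : (1 : ℝ) ≤ a 0 := by exact_mod_cast ha1 0
    linarith [h1.1]
  have := sqrt_thirteen_lt
  have h4 : (1 / 2.8 : ℝ) + 1 / 3.8 > 0.62 := by norm_num
  linarith [h2.1]

lemma eq_one_or_two_of_lam_le {β : ℤ → ℕ} (hβ : ∀ i, 1 ≤ β i) {m : ℝ} (hm : m < Real.sqrt 13)
    (h : ∀ n, lam β n ≤ m) (n : ℤ) : β n = 1 ∨ β n = 2 := by
  have h3 : ∀ n, β n ≤ 3 := by
    intro n
    have h1 := cf01_pos (a := fun k : ℕ => β (n + 1 + k)) fun _ => hβ _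
    have h2 := cf01_pos (a := fun k : ℕ => β (n - 1 - k)) fun _ => hβ _
    have h4 := h n
    rw [lam] at h4
    have h5 := sqrt_thirteen_lt
    have : (β n : ℝ) < 4 := by linarith
    have : β n < 4 := by exact_mod_cast this
    omega
  suffices β n ≠ 3 by
    have := h3 n
    have := hβ n
    omega
  intro hn
  have hlt : ∀ i, β i = 3 →
      3 + cf01 (fun k : ℕ => β (i + 1 + k)) + cf01 (fun k : ℕ => β (i - 1 - k)) <
        Real.sqrt 13 := by
    intro i hi
    have := (h i).trans_lt hm
    rwa [lam, hi] at this
  have hr : ∀ i, β i = 3 → β (i + 1) = 3 := fun i hi => by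
    simpa using eq_three_of_add_lt (fun _ => hβ _) (fun _ => h3 _) (fun _ => hβ _) (fun _ => h3 _)
      (hlt i hi)
  have hl : ∀ i, β i = 3 → β (i - 1) = 3 := fun i hi => by
    have := hlt i hi
    rw [add_right_comm] at this
    simpa using eq_three_of_add_lt (fun _ => hβ _) (fun _ => h3 _) (fun _ => hβ _) (fun _ => h3 _)
      this
  have hall : ∀ k, β (n + k) = 3 := by
    intro k
    induction k using Int.induction_on with
    | zero => simpa using hn
    | succ k ih => rw [← add_assoc]; exact hr _ ih
    | pred k ih => rw [← add_sub_assoc]; exact hl _ ih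
  have hall' : ∀ i, β i = 3 := fun i => by simpa using hall (i - n)
  have := hlt n hn
  simp only [hall'] at this
  exact this.ne cf01_const_three

/-- A Markov value below `√13` is attained at the origin by a sequence over `{1, 2}`. -/
lemma exists_lam_eq_of_mem_markovSpectrum {m : ℝ} (hm : m ∈ MarkovSpectrum) (h0 : 0 < m)
    (h13 : m < Real.sqrt 13) :
    ∃ α : ℤ → ℕ, (∀ i, α i = 1 ∨ α i = 2) ∧ (∀ n, lam α n ≤ m) ∧ lam α 0 = m := by
  obtain ⟨β, hβ, hβm⟩ := hm
  have hfun : (fun n : ℤ => lambda0 (shiftZ n β)) = lam β := funext fun n => lambda0_shiftZ hβ n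
  rw [markovValue, hfun] at hβm
  have hbdd : BddAbove (Set.range (lam β)) := by
    by_contra hb
    rw [Real.iSup_of_not_bddAbove hb] at hβm
    exact h0.ne hβm
  have hle : ∀ n, lam β n ≤ m := fun n => hβm ▸ le_ciSup hbdd n
  have h12 := eq_one_or_two_of_lam_le hβ h13 hle
  have hex : ∀ k : ℕ, ∃ n : ℤ, m - 1 / (k + 1) < lam β n := fun k => by
    refine exists_lt_of_lt_ciSup ?_
    rw [hβm]
    linarith [Nat.one_div_pos_of_nat (α := ℝ) (n := k)]
  choose c hc using hex
  have hcomp : IsCompact (Set.univ.pi fun _ : ℤ => ({1, 2} : Set ℕ)) :=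
    isCompact_univ_pi fun _ => (Set.toFinite _).isCompact
  obtain ⟨α, hα, φ, hφ, hlim⟩ := hcomp.tendsto_subseq (x := fun k i => β (i + c k))
    (fun k i _ => h12 _)
  have hα12 : ∀ i, α i = 1 ∨ α i = 2 := fun i => hα i (Set.mem_univ _)
  have hev : ∀ i, ∀ᶠ k in atTop, β (i + c (φ k)) = α i := fun i => by
    have := tendsto_pi_nhds.1 hlim i
    rw [nhds_discrete, tendsto_pure] at this
    exact this
  have hlam : ∀ n, Tendsto (fun k => lam β (n + c (φ k))) atTop (nhds (lam α n)) := fun n => by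
    simpa only [lam_comp_add] using tendsto_lam (β := fun k i => β (i + c (φ k)))
      (fun i => by rcases hα12 i with h | h <;> omega) (fun k i => hβ _) hev n
  refine ⟨α, hα12, fun n => le_of_tendsto' (hlam n) fun k => hle _, ?_⟩
  refine tendsto_nhds_unique (hlam 0) (tendsto_of_tendsto_of_tendsto_of_le_of_le
    (g := fun k => m - 1 / ((φ k : ℝ) + 1)) ?_ tendsto_const_nhds (fun k => ?_) fun k => hle _)
  · simpa using tendsto_const_nhds.sub
      ((tendsto_one_div_add_atTop_nhds_zero_nat (𝕜 := ℝ)).comp hφ.tendsto_atTop)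
  · simpa using (hc (φ k)).le

/-! ### Sequences that can be continued by `1`s -/

/-- Every central block of `α` extends to a sequence over `{1, 2}` that is eventually `1` to the
right and whose local values exceed `m` by arbitrarily little. -/
def RightConn (α : ℤ → ℕ) (m : ℝ) : Prop :=
  ∀ N : ℕ, ∀ ε : ℝ, 0 < ε → ∃ γ : ℤ → ℕ, (∀ i, γ i = 1 ∨ γ i = 2) ∧
    (∀ i, -(N : ℤ) ≤ i → i ≤ N → γ i = α i) ∧ (∀ n, lam γ n ≤ m + ε) ∧ ∃ B, ∀ i ≥ B, γ i = 1

lemma one_le_of_eq_one_or_two {ι : Type*} {γ : ι → ℕ} (h : ∀ i, γ i = 1 ∨ γ i = 2) (i : ι) :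
    1 ≤ γ i := by
  rcases h i with h | h <;> omega

lemma RightConn.exists_two_sided {α : ℤ → ℕ} {m : ℝ} (hr : RightConn α m)
    (hl : RightConn (fun i => α (-i)) m) (N : ℕ) {ε : ℝ} (hε : 0 < ε) :
    ∃ (δ : ℤ → ℕ) (B : ℕ), (∀ i, δ i = 1 ∨ δ i = 2) ∧
      (∀ i, -(N : ℤ) ≤ i → i ≤ N → δ i = α i) ∧ (∀ n, lam δ n ≤ m + ε) ∧
      ∀ i, (B : ℤ) < |i| → δ i = 1 := by
  obtain ⟨j, hj⟩ := exists_pow_lt_of_lt_one (by positivity : 0 < ε / 4)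
    (by norm_num : (1 / 4 : ℝ) < 1)
  obtain ⟨γ, hγ, hγα, hγm, B, hB⟩ := hr (N + 2 * j) (ε / 2) (by positivity)
  obtain ⟨γ', hγ', hγα', hγm', B', hB'⟩ := hl (N + 2 * j) (ε / 2) (by positivity)
  push_cast at hγα hγα'
  have hδ : ∀ i : ℤ, (if 0 ≤ i then γ i else γ' (-i)) = 1 ∨
      (if 0 ≤ i then γ i else γ' (-i)) = 2 := fun i => by
    split_ifs
    exacts [hγ _, hγ' _]
  refine ⟨fun i => if 0 ≤ i then γ i else γ' (-i), (max B B').toNat, hδ, fun i h1 h2 => ?_,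
    fun n => ?_, fun i hi => ?_⟩
  · dsimp only
    split_ifs
    · exact hγα i (by omega) (by omega)
    · simpa using hγα' (-i) (by omega) (by omega)
  · rcases le_or_gt 0 n with hn | hn
    · have := abs_lam_sub_le (one_le_of_eq_one_or_two hδ) (one_le_of_eq_one_or_two hγ) j (n := n)
        (fun i h1 h2 => by
          split_ifs with h
          · rfl
          · rw [hγα i (by omega) (by omega), hγα' (-i) (by omega) (by omega), neg_neg])
      have h3 := hγm n
      linarith [(abs_le.1 this).2]
    · have := abs_lam_sub_le (β := fun i => γ' (-i)) (one_le_of_eq_one_or_two hδ)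
        (fun i => one_le_of_eq_one_or_two hγ' _) j (n := n)
        (fun i h1 h2 => by
          split_ifs with h
          · rw [hγα i (by omega) (by omega), hγα' (-i) (by omega) (by omega), neg_neg]
          · rfl)
      rw [lam_comp_neg] at this
      have h3 := hγm' (-n)
      linarith [(abs_le.1 this).2]
  · dsimp only
    split_ifs with h
    · rw [abs_of_nonneg h] at hi
      exact hB i (by omega)
    · rw [abs_of_neg (by omega)] at hi
      exact hB' (-i) (by omega)

lemma lam_le_three {α : ℤ → ℕ} (hα : ∀ i, 1 ≤ α i) {n : ℤ} (h : α n = 1) : lam α n ≤ 3 := by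
  have h1 := cf01_le_one (a := fun k : ℕ => α (n + 1 + k)) fun _ => hα _
  have h2 := cf01_le_one (a := fun k : ℕ => α (n - 1 - k)) fun _ => hα _
  rw [lam, h]
  push_cast
  linarith

/-- Centres of consecutive blocks with radii `D k`. -/
def blockCentre (D : ℕ → ℕ) : ℕ → ℕ
  | 0 => D 0
  | k + 1 => blockCentre D k + D k + D (k + 1) + 2

lemma le_blockCentre (D : ℕ → ℕ) (k : ℕ) : k ≤ blockCentre D k := by
  induction k with
  | zero => simp
  | succ k ih => rw [blockCentre]; omega

lemma blockCentre_add_lt (D : ℕ → ℕ) {j k : ℕ} (h : j < k) :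
    blockCentre D j + D j + D k < blockCentre D k := by
  induction k with
  | zero => omega
  | succ k ih =>
    rw [blockCentre]
    rcases (Nat.lt_succ_iff_lt_or_eq.1 h) with h | rfl
    · have := ih h
      omega
    · omega

lemma mem_lagrangeSpectrum_of_rightConn {α : ℤ → ℕ} {m : ℝ} (hα : ∀ i, α i = 1 ∨ α i = 2)
    (hm : lam α 0 = m) (hm3 : 3 ≤ m) (hr : RightConn α m)
    (hl : RightConn (fun i => α (-i)) m) : m ∈ LagrangeSpectrum := by
  choose δ B hδ hδα hδm hδB using fun k : ℕ =>
    hr.exists_two_sided hl k (Nat.one_div_pos_of_nat (α := ℝ) (n := k))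
  set D : ℕ → ℕ := fun k => B k + k with hD
  set c : ℕ → ℤ := fun k => (blockCentre D k : ℤ) with hc
  have hsep : ∀ {j k : ℕ}, j < k → c j + D j + D k < c k := fun h => by
    simp only [hc]
    exact_mod_cast blockCentre_add_lt D h
  classical
  set θ : ℤ → ℕ := fun i => if ∃ k, δ k (i - c k) = 2 then 2 else 1 with hθ
  have hθ12 : ∀ i, θ i = 1 ∨ θ i = 2 := fun i => by
    simp only [hθ]; split_ifs <;> simp
  have hθ1 := one_le_of_eq_one_or_two hθ12
  have hblock : ∀ {k : ℕ} {i : ℤ}, δ k (i - c k) = 2 → |i - c k| ≤ B k := by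
    intro k i h
    by_contra hlt
    have := hδB k _ (not_le.1 hlt)
    omega
  have hθδ : ∀ k i, |i - c k| ≤ D k → θ i = δ k (i - c k) := by
    intro k i hi
    rcases hδ k (i - c k) with h | h
    · rw [h, hθ]
      refine if_neg ?_
      rintro ⟨l, hl⟩
      have h1 := abs_le.1 (hblock hl)
      have h2 := abs_le.1 hi
      have h3 : (D l : ℤ) = B l + l := by simp [hD]
      rcases lt_trichotomy k l with h' | rfl | h'
      · have := hsep h'
        omega
      · omega
      · have := hsep h'
        omega
    · rw [h, hθ]
      exact if_pos ⟨k, h⟩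
  have hclose : ∀ (k : ℕ) (n : ℤ), |n - c k| ≤ B k →
      |lam θ n - lam (δ k) (n - c k)| ≤ 2 * (1 / 4) ^ (k / 2) := by
    intro k n hn
    have := abs_lam_sub_le (β := fun i => δ k (i - c k)) hθ1
      (fun i => one_le_of_eq_one_or_two (hδ k) _) (k / 2) (n := n) (fun i h1 h2 => hθδ k i (by
        have h3 : (D k : ℤ) = B k + k := by simp [hD]
        rw [abs_le] at *
        omega))
    simp only [sub_eq_add_neg] at this ⊢
    rwa [lam_comp_add] at this
  have herr : Tendsto (fun k : ℕ => 1 / ((k : ℝ) + 1) + 4 * (1 / 4) ^ (k / 2)) atTop (nhds 0) := by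
    have h1 := (tendsto_pow_atTop_nhds_zero_of_lt_one (r := (1 / 4 : ℝ)) (by norm_num)
      (by norm_num)).comp (Nat.tendsto_div_const_atTop (n := 2) (by norm_num))
    simpa using (tendsto_one_div_add_atTop_nhds_zero_nat (𝕜 := ℝ)).add (h1.const_mul 4)
  have hupper : ∀ ε > 0, ∀ᶠ n : ℕ in atTop, lam θ n ≤ m + ε := by
    intro ε hε
    obtain ⟨K, hK⟩ := eventually_atTop.1 (herr.eventually (gt_mem_nhds hε))
    refine eventually_atTop.2 ⟨blockCentre D K, fun n hn => ?_⟩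
    have hn' : c K ≤ n := by simp only [hc]; exact_mod_cast hn
    rcases hθ12 n with h | h
    · linarith [lam_le_three hθ1 h]
    · obtain ⟨k, hk⟩ : ∃ k, δ k (n - c k) = 2 := by
        by_contra hne
        simp only [hθ, if_neg hne] at h
        omega
      have h1 := hblock hk
      have hKk : K ≤ k := by
        by_contra hlt
        have h2 := hsep (not_le.1 hlt)
        have h3 := abs_le.1 h1
        have h4 : (D k : ℤ) = B k + k := by simp [hD]
        omega
      have h2 := (abs_le.1 (hclose k n h1)).2
      have h3 := hδm k (n - c k)
      have h4 := hK k hKk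
      have h5 : (0 : ℝ) < (1 / 4) ^ (k / 2) := by positivity
      linarith
  have hlower : ∀ ε > 0, ∃ᶠ n : ℕ in atTop, m - ε ≤ lam θ n := by
    intro ε hε
    obtain ⟨K, hK⟩ := eventually_atTop.1 (herr.eventually (gt_mem_nhds hε))
    refine frequently_atTop.2 fun N => ⟨blockCentre D (max N K),
      (le_max_left N K).trans (le_blockCentre D _), ?_⟩
    set k := max N K
    have h1 := (abs_le.1 (hclose k (c k) (by simp))).1
    have h2 := (abs_le.1 (abs_lam_sub_le (one_le_of_eq_one_or_two (hδ k))
      (one_le_of_eq_one_or_two hα) (k / 2) (n := 0)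
      (fun i h1 h2 => hδα k i (by omega) (by omega)))).1
    have h3 := hK k (le_max_right N K)
    have h5 : (0 : ℝ) < 1 / ((k : ℝ) + 1) := Nat.one_div_pos_of_nat
    rw [sub_self] at h1
    change m - ε ≤ lam θ (c k)
    linarith
  have hbdd : IsBoundedUnder (· ≤ ·) atTop fun n : ℕ => lam θ n := ⟨m + 1, hupper 1 one_pos⟩
  have hcobdd : IsCoboundedUnder (· ≤ ·) atTop fun n : ℕ => lam θ n :=
    IsCoboundedUnder.of_frequently_ge (hlower 1 one_pos)
  refine ⟨θ, hθ1, ?_⟩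
  rw [lagrangeValue]
  simp only [lambda0_shiftZ hθ1]
  refine le_antisymm (le_of_forall_pos_le_add fun ε hε => ?_)
    (le_of_forall_pos_sub_le fun ε hε => ?_)
  · exact limsup_le_of_le hcobdd (hupper ε hε)
  · exact le_limsup_of_frequently_le (hlower ε hε) hbdd

/-! ### Branching of sequences that cannot be continued by `1`s -/

lemma inv_add_mem_uIcc {d x y z : ℝ} (hd : 0 < d) (hx : 0 ≤ x) (hy : 0 ≤ y)
    (hz : z ∈ Set.uIcc x y) : 1 / (d + z) ∈ Set.uIcc (1 / (d + x)) (1 / (d + y)) := by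
  wlog h : x ≤ y generalizing x y
  · rw [Set.uIcc_comm] at hz ⊢
    exact this hy hx hz (le_of_not_ge h)
  rw [Set.uIcc_of_le h] at hz
  have hz0 : 0 ≤ z := hx.trans hz.1
  rw [Set.uIcc_of_ge (one_div_le_one_div_of_le (by positivity) (by linarith))]
  exact ⟨one_div_le_one_div_of_le (by positivity) (by linarith [hz.2]),
    one_div_le_one_div_of_le (by positivity) (by linarith [hz.1])⟩

lemma cf01_mem_uIcc (n : ℕ) : ∀ {a b c : ℕ → ℕ}, (∀ k, 1 ≤ a k) → (∀ k, 1 ≤ b k) →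
    (∀ k, 1 ≤ c k) → (∀ k < n, a k = c k) → (∀ k < n, b k = c k) →
    cf01 (fun k => c (n + k)) ∈ Set.uIcc (cf01 fun k => a (n + k)) (cf01 fun k => b (n + k)) →
    cf01 c ∈ Set.uIcc (cf01 a) (cf01 b) := by
  induction n with
  | zero => intro a b c _ _ _ _ _ h; simpa using h
  | succ n ih =>
    intro a b c ha hb hc hac hbc h
    have ha1 : ∀ k, 1 ≤ (fun k => a (k + 1)) k := fun k => ha (k + 1)
    have hb1 : ∀ k, 1 ≤ (fun k => b (k + 1)) k := fun k => hb (k + 1)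
    have hc1 : ∀ k, 1 ≤ (fun k => c (k + 1)) k := fun k => hc (k + 1)
    rw [cf01_eq ha, cf01_eq hb, cf01_eq hc, hac 0 (by omega), hbc 0 (by omega)]
    refine inv_add_mem_uIcc (by exact_mod_cast hc 0) (cf01_pos ha1).le (cf01_pos hb1).le
      (ih ha1 hb1 hc1 (fun k hk => hac _ (by omega)) (fun k hk => hbc _ (by omega)) ?_)
    simpa only [add_right_comm n _ 1] using h

lemma cf01_mem_of_eq_one_or_two {a : ℕ → ℕ} (ha : ∀ n, a n = 1 ∨ a n = 2) :
    4 / 11 ≤ cf01 a ∧ cf01 a ≤ 3 / 4 := by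
  have key : ∀ {a : ℕ → ℕ}, (∀ n, a n = 1 ∨ a n = 2) → 1 / 3 ≤ cf01 a ∧ cf01 a ≤ 1 := by
    intro a ha
    have h1 := one_le_of_eq_one_or_two ha
    refine ⟨?_, cf01_le_one h1⟩
    have h2 : (a 0 : ℝ) ≤ 2 := by rcases ha 0 with h | h <;> norm_num [h]
    have h3 := cf01_le_one (a := fun k => a (k + 1)) fun n => h1 _
    have h4 := cf01_pos (a := fun k => a (k + 1)) fun n => h1 _
    rw [cf01_eq h1]
    exact one_div_le_one_div_of_le (by positivity) (by linarith)
  have key2 : ∀ {a : ℕ → ℕ}, (∀ n, a n = 1 ∨ a n = 2) → cf01 a ≤ 3 / 4 := by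
    intro a ha
    have h1 := one_le_of_eq_one_or_two ha
    have h2 : (1 : ℝ) ≤ a 0 := by exact_mod_cast h1 0
    have h3 := key (a := fun k => a (k + 1)) fun n => ha _
    rw [cf01_eq h1, div_le_iff₀ (by linarith)]
    linarith
  have h1 := one_le_of_eq_one_or_two ha
  refine ⟨?_, key2 ha⟩
  have h2 : (a 0 : ℝ) ≤ 2 := by rcases ha 0 with h | h <;> norm_num [h]
  have h3 := key2 (a := fun k => a (k + 1)) fun n => ha _
  have h4 := cf01_pos (a := fun k => a (k + 1)) fun n => h1 _
  rw [cf01_eq h1, le_div_iff₀ (by positivity)]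
  linarith

lemma cf01_const_one : 0.618 ≤ cf01 (fun _ => 1) ∧ cf01 (fun _ => 1) ≤ 0.6181 := by
  have h := cf01_eq (a := fun _ => 1) (fun _ => by norm_num)
  have h0 := cf01_pos (a := fun _ => 1) (fun _ => by norm_num)
  set c := cf01 fun _ => 1
  rw [eq_div_iff (by positivity)] at h
  push_cast at h
  constructor <;> nlinarith

/-- The bi-infinite sequence equal to `α` before `P` and continued by `w` from `P` on. -/
def splice (α : ℤ → ℕ) (P : ℤ) (w : ℕ → ℕ) : ℤ → ℕ :=
  fun i => if i < P then α i else w (i - P).toNat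

lemma splice_of_lt {α : ℤ → ℕ} {P i : ℤ} {w : ℕ → ℕ} (h : i < P) : splice α P w i = α i :=
  if_pos h

lemma splice_add (α : ℤ → ℕ) (P : ℤ) (w : ℕ → ℕ) (s : ℕ) : splice α P w (P + s) = w s := by
  rw [splice, if_neg (by omega)]
  congr 1
  omega

lemma splice_eq_one_or_two {α : ℤ → ℕ} {w : ℕ → ℕ} (hα : ∀ i, α i = 1 ∨ α i = 2)
    (hw : ∀ n, w n = 1 ∨ w n = 2) (P i : ℤ) : splice α P w i = 1 ∨ splice α P w i = 2 := by
  rw [splice]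
  split_ifs
  exacts [hα _, hw _]

/-- The backward continued fraction of a spliced sequence seen from position `P + s`. -/
noncomputable def spliceLeft (α : ℤ → ℕ) (P : ℤ) (w : ℕ → ℕ) (s : ℕ) : ℝ :=
  cf01 fun k : ℕ => splice α P w (P + s - 1 - k)

lemma lam_splice_add (α : ℤ → ℕ) (P : ℤ) (w : ℕ → ℕ) (s : ℕ) :
    lam (splice α P w) (P + s) = w s + cf01 (fun k => w (s + 1 + k)) + spliceLeft α P w s := by
  rw [lam, splice_add, spliceLeft]
  congr 3
  funext k
  rw [← splice_add α P w]
  congr 1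
  push_cast
  ring

lemma spliceLeft_succ {α : ℤ → ℕ} {w : ℕ → ℕ} (hα : ∀ i, α i = 1 ∨ α i = 2)
    (hw : ∀ n, w n = 1 ∨ w n = 2) (P : ℤ) (s : ℕ) :
    spliceLeft α P w (s + 1) = 1 / (w s + spliceLeft α P w s) := by
  rw [spliceLeft, cf01_eq fun k => one_le_of_eq_one_or_two (splice_eq_one_or_two hα hw P) _,
    spliceLeft, ← splice_add α P w s]
  congr 3
  · congr 1; push_cast; ring
  · funext k; congr 1; push_cast; ring

lemma spliceLeft_mem {α : ℤ → ℕ} {w : ℕ → ℕ} (hα : ∀ i, α i = 1 ∨ α i = 2)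
    (hw : ∀ n, w n = 1 ∨ w n = 2) (P : ℤ) (s : ℕ) :
    4 / 11 ≤ spliceLeft α P w s ∧ spliceLeft α P w s ≤ 3 / 4 :=
  cf01_mem_of_eq_one_or_two fun _ => splice_eq_one_or_two hα hw P _

lemma lam_splice_le_of_lt {α α' : ℤ → ℕ} {w : ℕ → ℕ} {P : ℤ} {j : ℕ} {M : ℝ}
    (hα : ∀ i, α i = 1 ∨ α i = 2) (hα' : ∀ i, α' i = 1 ∨ α' i = 2)
    (hw : ∀ n, w n = 1 ∨ w n = 2) (hP : 2 * j < P)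
    (hag : ∀ i, -(2 * j : ℤ) ≤ i → i < P → α i = α' i)
    (hM : ∀ n, lam α n ≤ M) (hM' : ∀ n, lam α' n ≤ M)
    (hbt : cf01 w ∈ Set.uIcc (cf01 fun k : ℕ => α (P + k)) (cf01 fun k : ℕ => α' (P + k)))
    {i : ℤ} (hi : i < P) : lam (splice α P w) i ≤ M + 2 * (1 / 4) ^ j := by
  have h1 := one_le_of_eq_one_or_two hα
  have h1' := one_le_of_eq_one_or_two hα'
  have hs := splice_eq_one_or_two hα hw P
  have hη : (0 : ℝ) < (1 / 4) ^ j := by positivity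
  rcases lt_or_ge i 0 with h0 | h0
  · have := abs_lam_sub_le (one_le_of_eq_one_or_two hs) h1 j (n := i)
      (fun l _ hl => splice_of_lt (by omega))
    linarith [(abs_le.1 this).2, hM i]
  obtain ⟨n, hn⟩ : ∃ n : ℕ, P = i + 1 + n := ⟨(P - i - 1).toNat, by omega⟩
  have hshift : ∀ β : ℤ → ℕ,
      (fun k : ℕ => β (i + 1 + ((n + k : ℕ) : ℤ))) = fun k : ℕ => β (P + k) := fun β => by
    funext k; congr 1; push_cast; omega
  have hsw : (fun k : ℕ => splice α P w (P + k)) = w := funext fun k => splice_add α P w k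
  have hR := cf01_mem_uIcc n (a := fun k : ℕ => α (i + 1 + k)) (b := fun k : ℕ => α' (i + 1 + k))
    (c := fun k : ℕ => splice α P w (i + 1 + k)) (fun _ => h1 _) (fun _ => h1' _)
    (fun _ => one_le_of_eq_one_or_two hs _) (fun k hk => (splice_of_lt (by omega)).symm)
    (fun k hk => by rw [splice_of_lt (by omega), hag _ (by omega) (by omega)])
    (by rw [hshift, hshift, hshift, hsw]; exact hbt)
  have hL : cf01 (fun k : ℕ => splice α P w (i - 1 - k)) = cf01 (fun k : ℕ => α (i - 1 - k)) := by
    congr 1; funext k; exact splice_of_lt (by omega)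
  have hL' := abs_cf01_sub_le j (a := fun k : ℕ => α (i - 1 - k))
    (b := fun k : ℕ => α' (i - 1 - k)) (fun _ => h1 _) (fun _ => h1' _)
    (fun k hk => hag _ (by omega) (by omega))
  have e1 := hM i
  have e2 := hM' i
  rw [lam] at e1 e2
  rw [lam, splice_of_lt hi, hL]
  rw [← hag i (by omega) hi] at e2
  have := (abs_le.1 hL').2
  rcases le_max_iff.1 hR.2 with h | h <;> linarith

lemma cf01_tail_eq {β : ℤ → ℕ} (hβ : ∀ i, β i = 1 ∨ β i = 2) (s : ℤ) :
    cf01 (fun k : ℕ => β (s + k)) = 1 / (β s + cf01 (fun k : ℕ => β (s + 1 + k))) := by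
  rw [cf01_eq fun k => one_le_of_eq_one_or_two hβ _]
  congr 3
  · simp
  · funext k; congr 1; push_cast; ring

lemma cf01_tail_mem {β : ℤ → ℕ} (hβ : ∀ i, β i = 1 ∨ β i = 2) (s : ℤ) :
    4 / 11 ≤ cf01 (fun k : ℕ => β (s + k)) ∧ cf01 (fun k : ℕ => β (s + k)) ≤ 3 / 4 :=
  cf01_mem_of_eq_one_or_two fun _ => hβ _

lemma half_le_cf01_tail {β : ℤ → ℕ} (hβ : ∀ i, β i = 1 ∨ β i = 2) {s : ℤ} (hs : β s = 1) :
    1 / 2 ≤ cf01 (fun k : ℕ => β (s + k)) := by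
  have := cf01_tail_mem hβ (s + 1)
  rw [cf01_tail_eq hβ, hs]
  push_cast
  exact one_div_le_one_div_of_le (by linarith) (by linarith)

lemma cf01_tail_le_half {β : ℤ → ℕ} (hβ : ∀ i, β i = 1 ∨ β i = 2) {s : ℤ} (hs : β s = 2) :
    cf01 (fun k : ℕ => β (s + k)) ≤ 1 / 2 := by
  have := cf01_tail_mem hβ (s + 1)
  rw [cf01_tail_eq hβ, hs]
  push_cast
  exact one_div_le_one_div_of_le (by linarith) (by linarith)

/-- A continuation between the two branches has a digit `2` with a large local value. -/
lemma exists_lt_lam_splice {α α' : ℤ → ℕ} {P : ℤ} {j : ℕ} {M : ℝ}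
    (hα : ∀ i, α i = 1 ∨ α i = 2) (hα' : ∀ i, α' i = 1 ∨ α' i = 2) (hP : 2 * j < P)
    (hag : ∀ i, -(2 * j : ℤ) ≤ i → i < P → α i = α' i)
    (hM : ∀ n, lam α n ≤ M) (hM' : ∀ n, lam α' n ≤ M) (hM3 : 3.042 < M)
    (hno : ∀ w : ℕ → ℕ, (∀ n, w n = 1 ∨ w n = 2) → (∀ n ≥ 4, w n = 1) →
      ¬ ∀ n, lam (splice α P w) n ≤ M + 2 * (1 / 4) ^ j)
    {w : ℕ → ℕ} (hw : ∀ n, w n = 1 ∨ w n = 2) (hw4 : ∀ n ≥ 4, w n = 1)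
    (hle : cf01 (fun k : ℕ => α' (P + k)) ≤ cf01 w)
    (hle' : cf01 w ≤ cf01 (fun k : ℕ => α (P + k))) :
    ∃ s : ℕ, w s = 2 ∧
      M + 2 * (1 / 4) ^ j < w s + cf01 (fun k => w (s + 1 + k)) + spliceLeft α P w s := by
  by_contra! hs
  have hη : (0 : ℝ) < (1 / 4) ^ j := by positivity
  refine hno w hw hw4 fun n => ?_
  rcases lt_or_ge n P with hn | hn
  · exact lam_splice_le_of_lt hα hα' hw hP hag hM hM'
      (Set.mem_uIcc.2 (Or.inr ⟨hle, hle'⟩)) hn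
  obtain ⟨s, rfl⟩ : ∃ s : ℕ, n = P + s := ⟨(n - P).toNat, by omega⟩
  rcases hw s with h | h
  · have := lam_le_three (one_le_of_eq_one_or_two (splice_eq_one_or_two hα hw P))
      (n := P + s) (by rw [splice_add, h])
    linarith
  · rw [lam_splice_add]
    exact hs s h

lemma branch_one_forced {α α' : ℤ → ℕ} {P : ℤ} {j : ℕ} {M : ℝ}
    (hα : ∀ i, α i = 1 ∨ α i = 2) (hα' : ∀ i, α' i = 1 ∨ α' i = 2) (hP : 2 * j < P)
    (hag : ∀ i, -(2 * j : ℤ) ≤ i → i < P → α i = α' i)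
    (hM : ∀ n, lam α n ≤ M) (hM' : ∀ n, lam α' n ≤ M) (hM3 : 3.042 < M)
    (hno : ∀ w : ℕ → ℕ, (∀ n, w n = 1 ∨ w n = 2) → (∀ n ≥ 4, w n = 1) →
      ¬ ∀ n, lam (splice α P w) n ≤ M + 2 * (1 / 4) ^ j)
    (hPα : α P = 1) (hPα' : α' P = 2) : α (P + 1) = 1 ∧ α (P + 2) = 2 := by
  have hη : (0 : ℝ) < (1 / 4) ^ j := by positivity
  obtain ⟨hg1, hg2⟩ := cf01_const_one
  have hα0' := cf01_tail_le_half hα' hPα'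
  have a0 := cf01_tail_eq hα P
  rw [hPα, Nat.cast_one] at a0
  have A1 := cf01_tail_mem hα (P + 1)
  have A2 := cf01_tail_mem hα (P + 1 + 1)
  have hα1 : α (P + 1) = 1 := by
    refine (hα (P + 1)).resolve_right fun h => ?_
    have h2 := cf01_tail_le_half hα h
    obtain ⟨s, hs, -⟩ := exists_lt_lam_splice hα hα' hP hag hM hM' hM3 hno
      (w := fun _ => 1) (fun _ => Or.inl rfl) (fun _ _ => rfl) (by linarith) (by
        rw [a0, le_div_iff₀ (by linarith)]
        nlinarith)
    omega
  refine ⟨hα1, (hα (P + 2)).resolve_left fun h => ?_⟩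
  set w : ℕ → ℕ := fun n => if n = 2 ∨ n = 3 then 2 else 1 with hwdef
  have hw : ∀ n, w n = 1 ∨ w n = 2 := fun n => by rw [hwdef]; dsimp only; split_ifs <;> simp
  have hw1 := one_le_of_eq_one_or_two hw
  have d0 : w 0 = 1 := rfl
  have d1 : w 1 = 1 := rfl
  have d2 : w 2 = 2 := rfl
  have d3 : w 3 = 2 := rfl
  have hw4 : ∀ n ≥ 4, w n = 1 := fun n hn => if_neg (by omega)
  have w4 : cf01 (fun k => w (3 + 1 + k)) = cf01 (fun _ => 1) := by
    congr 1; funext k; exact hw4 _ (by omega)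
  have w3 : cf01 (fun k => w (2 + 1 + k)) = 1 / (2 + cf01 (fun _ => 1)) := by
    rw [cf01_eq fun _ => hw1 _, ← w4, d3]
    congr 3
    funext k; congr 1; omega
  have w2 : cf01 (fun k => w (k + 1 + 1)) = 1 / (2 + 1 / (2 + cf01 (fun _ => 1))) := by
    rw [cf01_eq fun _ => hw1 _, ← w3, d2]
    congr 3
    funext k; congr 1; omega
  have w0 : cf01 w = 1 / (1 + 1 / (1 + cf01 (fun k => w (k + 1 + 1)))) := by
    rw [cf01_eq hw1, cf01_eq fun _ => hw1 _, d0, d1, Nat.cast_one]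
  have x0 : 0 < cf01 (fun k => w (k + 1 + 1)) := cf01_pos fun _ => hw1 _
  have v3 : 1 / (2 + cf01 (fun _ => 1)) ≤ 0.382 := by
    rw [div_le_iff₀ (by linarith)]; linarith
  have v3' : 0 ≤ 1 / (2 + cf01 (fun _ => 1)) := by positivity
  clear_value w
  obtain ⟨s, hs, hlt⟩ := exists_lt_lam_splice hα hα' hP hag hM hM' hM3 hno hw hw4
    (hα0'.trans (by
      have : 1 / (1 + cf01 (fun k => w (k + 1 + 1))) ≤ 1 := by
        rw [div_le_one (by positivity)]; linarith
      rw [w0]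
      exact one_div_le_one_div_of_le (by positivity) (by linarith)))
    (by
      have e : P + 1 + 1 = P + 2 := by ring
      have a1 := cf01_tail_eq hα (P + 1)
      have h2 := half_le_cf01_tail hα h
      rw [hα1, Nat.cast_one, e] at a1
      have x1 : cf01 (fun k => w (k + 1 + 1)) ≤ cf01 (fun k : ℕ => α (P + 2 + k)) := by
        refine le_trans ?_ h2
        rw [w2]
        exact one_div_le_one_div_of_le (by linarith) (by linarith)
      have x2 : 1 / (1 + cf01 (fun k : ℕ => α (P + 2 + k))) ≤
          1 / (1 + cf01 (fun k => w (k + 1 + 1))) :=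
        one_div_le_one_div_of_le (by linarith) (by linarith)
      rw [w0, a0, a1]
      exact one_div_le_one_div_of_le (by positivity) (by linarith))
  have L0 := spliceLeft_mem hα hw P 0
  have L1 := spliceLeft_succ hα hw P 0
  have L2 := spliceLeft_succ hα hw P 1
  have L3 := spliceLeft_succ hα hw P 2
  have L1' := spliceLeft_mem hα hw P 1
  rw [d0, Nat.cast_one] at L1
  rw [d1, Nat.cast_one] at L2
  rw [d2, Nat.cast_two] at L3
  norm_num only at L1 L2 L3
  have l1 : 4 / 7 ≤ spliceLeft α P w 1 := by
    rw [L1, le_div_iff₀ (by linarith)]; linarith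
  have l2 : 1 / 2 ≤ spliceLeft α P w 2 ∧ spliceLeft α P w 2 ≤ 7 / 11 := by
    rw [L2, le_div_iff₀ (by linarith), div_le_iff₀ (by linarith)]
    constructor <;> linarith
  have l3 : spliceLeft α P w 3 ≤ 0.4 := by
    rw [L3, div_le_iff₀ (by linarith)]; linarith
  have hs' : s = 2 ∨ s = 3 := by
    by_contra hne
    rcases (by omega : s = 0 ∨ s = 1 ∨ 4 ≤ s) with rfl | rfl | h4
    · omega
    · omega
    · have := hw4 s h4
      omega
  rcases hs' with rfl | rfl
  · rw [w3, hs, Nat.cast_two] at hlt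
    linarith
  · rw [w4, hs, Nat.cast_two] at hlt
    linarith

lemma branch_two_forced {α α' : ℤ → ℕ} {P : ℤ} {j : ℕ} {M : ℝ}
    (hα : ∀ i, α i = 1 ∨ α i = 2) (hα' : ∀ i, α' i = 1 ∨ α' i = 2) (hP : 2 * j < P)
    (hag : ∀ i, -(2 * j : ℤ) ≤ i → i < P → α i = α' i)
    (hM : ∀ n, lam α n ≤ M) (hM' : ∀ n, lam α' n ≤ M) (hM3 : 3.042 < M)
    (hno : ∀ w : ℕ → ℕ, (∀ n, w n = 1 ∨ w n = 2) → (∀ n ≥ 4, w n = 1) →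
      ¬ ∀ n, lam (splice α P w) n ≤ M + 2 * (1 / 4) ^ j)
    (hPα : α P = 1) (hPα' : α' P = 2) : α' (P + 1) = 2 ∧ α' (P + 2) = 1 := by
  by_contra hcon
  have h1 := one_le_of_eq_one_or_two hα
  have h1' := one_le_of_eq_one_or_two hα'
  have hη : (0 : ℝ) < (1 / 4) ^ j := by positivity
  obtain ⟨hg1, hg2⟩ := cf01_const_one
  have hα0 := half_le_cf01_tail hα hPα
  have b0 := cf01_tail_eq hα' P
  rw [hPα', Nat.cast_two] at b0
  have B1 := cf01_tail_mem hα' (P + 1)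
  have B2 := cf01_tail_mem hα' (P + 1 + 1)
  set w : ℕ → ℕ := fun n => if n < 2 then 2 else 1 with hwdef
  have hw : ∀ n, w n = 1 ∨ w n = 2 := fun n => by rw [hwdef]; dsimp only; split_ifs <;> simp
  have hw1 := one_le_of_eq_one_or_two hw
  have d0 : w 0 = 2 := rfl
  have d1 : w 1 = 2 := rfl
  have hw2 : ∀ n ≥ 2, w n = 1 := fun n hn => if_neg (by omega)
  have w2 : cf01 (fun k => w (1 + 1 + k)) = cf01 (fun _ => 1) := by
    congr 1; funext k; exact hw2 _ (by omega)
  have w1 : cf01 (fun k => w (0 + 1 + k)) = 1 / (2 + cf01 (fun _ => 1)) := by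
    rw [cf01_eq fun _ => hw1 _, ← w2, d1]
    congr 3
    funext k; congr 1; omega
  have w0 : cf01 w = 1 / (2 + 1 / (2 + cf01 (fun _ => 1))) := by
    rw [cf01_eq hw1, ← w1, d0]
    congr 3
    funext k; congr 1; omega
  clear_value w
  have hc0 : 0 < 1 / (2 + cf01 (fun _ => 1)) := by positivity
  have hge : 1 / (2 + cf01 (fun _ => 1)) ≤ cf01 (fun k : ℕ => α' (P + 1 + k)) := by
    rw [cf01_tail_eq hα']
    rcases hα' (P + 1) with h | h
    · rw [h, Nat.cast_one]
      exact one_div_le_one_div_of_le (by linarith) (by linarith)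
    · have h2 : α' (P + 1 + 1) = 2 := by
        rw [show P + 1 + 1 = P + 2 by ring]
        exact (hα' _).resolve_left fun h' => hcon ⟨h, h'⟩
      have := cf01_tail_le_half hα' h2
      rw [h, Nat.cast_two]
      exact one_div_le_one_div_of_le (by linarith) (by linarith)
  obtain ⟨s, hs, hlt⟩ := exists_lt_lam_splice hα hα' hP hag hM hM' hM3 hno hw
    (fun n hn => hw2 n (by omega))
    (by
      rw [w0, b0]
      exact one_div_le_one_div_of_le (by linarith) (by linarith))
    (le_trans (by
      rw [w0]
      exact one_div_le_one_div_of_le (by linarith) (by linarith)) hα0)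
  rcases (by omega : s = 0 ∨ s = 1 ∨ 2 ≤ s) with rfl | rfl | h2
  · have hL : spliceLeft α P w 0 = cf01 (fun k : ℕ => α (P - 1 - k)) := by
      rw [spliceLeft]
      congr 1; funext k
      rw [splice_of_lt (by push_cast; omega)]
      congr 1; push_cast; ring
    have hL' := abs_cf01_sub_le j (a := fun k : ℕ => α (P - 1 - k))
      (b := fun k : ℕ => α' (P - 1 - k)) (fun _ => h1 _) (fun _ => h1' _)
      (fun k hk => hag _ (by omega) (by omega))
    have e2 := hM' P
    rw [lam, hPα', Nat.cast_two] at e2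
    rw [w1, hL, hs, Nat.cast_two] at hlt
    linarith [(abs_le.1 hL').2]
  · have L0 := spliceLeft_mem hα hw P 0
    have L1 := spliceLeft_succ hα hw P 0
    rw [d0, Nat.cast_two] at L1
    norm_num only at L1
    have l1 : spliceLeft α P w 1 ≤ 11 / 26 := by
      rw [L1, div_le_iff₀ (by linarith)]
      linarith
    rw [w2, hs, Nat.cast_two] at hlt
    linarith
  · have := hw2 s h2
    omega

/-! ### Covering `M \ L` -/

/-- Sequences over `{1, 2}` maximizing their local value at `0`, with prescribed central block of
radius `2 * j` and prescribed local value up to `(1 / 4) ^ j`, whose central block does not extend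
to a sequence that is eventually `1` to the right with almost the same bound on local values. -/
def deadEnds (j : ℕ) (u : List ℕ) (q : ℤ) : Set (ℤ → ℕ) :=
  { α | (∀ i, α i = 1 ∨ α i = 2) ∧ (∀ n, lam α n ≤ lam α 0) ∧ 3.042 < lam α 0 ∧
    ((List.range (4 * j + 1)).map fun k : ℕ => α (k - 2 * j)) = u ∧
    ⌊lam α 0 * 4 ^ j⌋ = q ∧
    ¬ ∃ γ : ℤ → ℕ, (∀ i, γ i = 1 ∨ γ i = 2) ∧
      (∀ i, -(2 * j : ℤ) ≤ i → i ≤ 2 * j → γ i = α i) ∧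
      (∀ n, lam γ n ≤ lam α 0 + 3 * (1 / 4) ^ j) ∧ ∃ B, ∀ i ≥ B, γ i = 1 }

/-- The right tail of a bi-infinite sequence. -/
def rightTail (α : ℤ → ℕ) (k : ℕ) : ℕ := α (0 + 1 + k)

lemma branch_forced_of_mem_deadEnds {j : ℕ} {u : List ℕ} {q : ℤ} {α α' : ℤ → ℕ}
    (hα : α ∈ deadEnds j u q) (hα' : α' ∈ deadEnds j u q) {P : ℤ} (hP : 0 < P)
    (hag : ∀ i, 0 < i → i < P → α i = α' i) (hPα : α P = 1) (hPα' : α' P = 2) :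
    (α (P + 1) = 1 ∧ α (P + 2) = 2) ∧ (α' (P + 1) = 2 ∧ α' (P + 2) = 1) := by
  obtain ⟨h12, hmax, h3, hu, hq, hno⟩ := hα
  obtain ⟨h12', hmax', h3', hu', hq', -⟩ := hα'
  have hcen : ∀ i, -(2 * j : ℤ) ≤ i → i ≤ 2 * j → α i = α' i := fun i h1 h2 => by
    have := List.map_inj_left.1 (hu.trans hu'.symm) (i + 2 * j).toNat
      (List.mem_range.2 (by omega))
    rwa [Int.toNat_of_nonneg (by omega), add_sub_cancel_right] at this
  have hjP : 2 * j < P := by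
    by_contra hlt
    have := hcen P (by omega) (by omega)
    omega
  have hag' : ∀ i, -(2 * j : ℤ) ≤ i → i < P → α i = α' i := fun i h1 h2 => by
    rcases le_or_gt i (2 * j) with h | h
    exacts [hcen i h1 h, hag i (by omega) h2]
  have hclose : lam α' 0 ≤ lam α 0 + (1 / 4) ^ j := by
    have h := Int.abs_sub_lt_one_of_floor_eq_floor (hq'.trans hq.symm)
    rw [← sub_mul] at h
    have h' := (abs_lt.1 h).2
    rw [← lt_div_iff₀ (by positivity)] at h'
    rw [one_div_pow]
    linarith
  have hη : (0 : ℝ) < (1 / 4) ^ j := by positivity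
  have hM : ∀ n, lam α n ≤ max (lam α 0) (lam α' 0) := fun n => (hmax n).trans (le_max_left _ _)
  have hM' : ∀ n, lam α' n ≤ max (lam α 0) (lam α' 0) :=
    fun n => (hmax' n).trans (le_max_right _ _)
  have hM3 : 3.042 < max (lam α 0) (lam α' 0) := lt_max_of_lt_left h3
  have hno' : ∀ w : ℕ → ℕ, (∀ n, w n = 1 ∨ w n = 2) → (∀ n ≥ 4, w n = 1) →
      ¬ ∀ n, lam (splice α P w) n ≤ max (lam α 0) (lam α' 0) + 2 * (1 / 4) ^ j := by
    refine fun w hw hw4 hle => hno ⟨splice α P w, splice_eq_one_or_two h12 hw P,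
      fun i _ _ => splice_of_lt (by omega), fun n => (hle n).trans ?_, P + 4, fun i hi => ?_⟩
    · linarith [max_le (by linarith : lam α 0 ≤ lam α 0 + (1 / 4) ^ j) hclose]
    · obtain ⟨s, rfl⟩ : ∃ s : ℕ, i = P + s := ⟨(i - P).toNat, by omega⟩
      rw [splice_add]
      exact hw4 s (by omega)
  exact ⟨branch_one_forced h12 h12' hjP hag' hM hM' hM3 hno' hPα hPα',
    branch_two_forced h12 h12' hjP hag' hM hM' hM3 hno' hPα hPα'⟩

lemma branchForced_image_rightTail (j : ℕ) (u : List ℕ) (q : ℤ) :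
    BranchForced (rightTail '' deadEnds j u q) := by
  constructor
  · rintro _ ⟨α, hα, rfl⟩ n
    exact hα.1 _
  rintro _ ⟨α, hα, rfl⟩ _ ⟨α', hα', rfl⟩ n hag hn hn'
  have h := branch_forced_of_mem_deadEnds hα hα' (P := 0 + 1 + n) (by omega)
    (fun i h1 h2 => by
      have := hag (i - 1).toNat (by omega)
      simp only [rightTail] at this
      rwa [show (0 : ℤ) + 1 + ((i - 1).toNat : ℤ) = i by omega] at this) hn hn'
  simpa only [rightTail, Nat.cast_add, Nat.cast_one, Nat.cast_ofNat, add_assoc] using h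

lemma dimH_iUnion_add_E2_le : dimH (⋃ d : ℕ, (fun x : ℝ => d + x) '' E2) ≤ dimH E2 := by
  rw [dimH_iUnion]
  exact iSup_le fun d => ((isometry_add_left (d : ℝ)).dimH_image E2).le

lemma dimH_image_lam_deadEnds_le (j : ℕ) (u : List ℕ) (q : ℤ) :
    dimH ((fun α => lam α 0) '' deadEnds j u q) ≤ ENNReal.ofReal 0.174813 + dimH E2 := by
  have hsub : (fun α => lam α 0) '' deadEnds j u q ⊆
      Set.image2 (· + ·) (cf01 '' (rightTail '' deadEnds j u q))
        (⋃ d : ℕ, (fun x : ℝ => d + x) '' E2) := by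
    rintro _ ⟨α, hα, rfl⟩
    refine ⟨_, ⟨_, ⟨α, hα, rfl⟩, rfl⟩, _, Set.mem_iUnion.2
      ⟨α 0, _, ⟨fun k : ℕ => α (0 - 1 - k), fun _ => hα.1 _, rfl⟩, rfl⟩, ?_⟩
    change cf01 (rightTail α) + (α 0 + _) = α 0 + cf01 (rightTail α) + _
    ring
  have h := dimH_image2_add_le (s := 18 / 103) (C := 100)
    (K := cf01 '' (rightTail '' deadEnds j u q))
    (F := ⋃ d : ℕ, (fun x : ℝ => d + x) '' E2) (by norm_num)
    (fun ρ h0 h1 => by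
      simpa only [NNReal.coe_div, NNReal.coe_ofNat] using
        (branchForced_image_rightTail j u q).exists_cover h0 h1)
  refine (dimH_mono hsub).trans (h.trans (add_le_add ?_ dimH_iUnion_add_E2_le))
  rw [ENNReal.ofReal, ENNReal.coe_le_coe, ← NNReal.coe_le_coe, Real.coe_toNNReal _ (by norm_num)]
  push_cast
  norm_num

lemma exists_mem_deadEnds {α : ℤ → ℕ} (h12 : ∀ i, α i = 1 ∨ α i = 2)
    (hmax : ∀ n, lam α n ≤ lam α 0) (h3 : 3.042 < lam α 0) (hr : ¬ RightConn α (lam α 0)) :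
    ∃ j u q, α ∈ deadEnds j u q := by
  simp only [RightConn, not_forall] at hr
  obtain ⟨N, ε, hε, hno⟩ := hr
  obtain ⟨k, hk⟩ := exists_pow_lt_of_lt_one (by positivity : 0 < ε / 3)
    (by norm_num : (1 / 4 : ℝ) < 1)
  refine ⟨max N k, _, _, h12, hmax, h3, rfl, rfl, fun ⟨γ, hγ, hγα, hγm, hB⟩ =>
    hno ⟨γ, hγ, fun i h1 h2 => hγα i ?_ ?_, fun n => (hγm n).trans ?_, hB⟩⟩
  · have : N ≤ max N k := le_max_left _ _
    omega
  · have : N ≤ max N k := le_max_left _ _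
    omega
  · have : (1 / 4 : ℝ) ^ max N k ≤ (1 / 4) ^ k :=
      pow_le_pow_of_le_one (by norm_num) (by norm_num) (le_max_right _ _)
    linarith

lemma markov_diff_lagrange_subset :
    (MarkovSpectrum \ LagrangeSpectrum) ∩ Set.Ioo 3.042 (Real.sqrt 13) ⊆
      ⋃ p : ℕ × List ℕ × ℤ, (fun α => lam α 0) '' deadEnds p.1 p.2.1 p.2.2 := by
  rintro m ⟨⟨hm, hmL⟩, h3, h13⟩
  obtain ⟨α, h12, hmax, rfl⟩ := exists_lam_eq_of_mem_markovSpectrum hm (by linarith) h13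
  by_cases hr : RightConn α (lam α 0)
  · have hl : ¬ RightConn (fun i => α (-i)) (lam α 0) := fun hl =>
      hmL (mem_lagrangeSpectrum_of_rightConn h12 rfl (by linarith) hr hl)
    have e : lam (fun i => α (-i)) 0 = lam α 0 := by rw [lam_comp_neg, neg_zero]
    obtain ⟨j, u, q, hmem⟩ := exists_mem_deadEnds (α := fun i => α (-i)) (fun i => h12 _)
      (fun n => by rw [e, lam_comp_neg]; exact hmax _) (by rwa [e]) (by rwa [e])
    exact Set.mem_iUnion.2 ⟨(j, u, q), _, hmem, e⟩
  · obtain ⟨j, u, q, hmem⟩ := exists_mem_deadEnds h12 hmax h3 hr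
    exact Set.mem_iUnion.2 ⟨(j, u, q), _, hmem, rfl⟩

/-- `dim_H ((M \ L) ∩ (3.042, √13)) ≤ 0.174813 + dim_H E₂ < 0.706094`. -/
theorem dimH_MminusL_3042_sqrt13 :
    dimH ((MarkovSpectrum \ LagrangeSpectrum) ∩ Set.Ioo 3.042 (Real.sqrt 13)) ≤
      ENNReal.ofReal 0.174813 + dimH E2 ∧
    ENNReal.ofReal 0.174813 + dimH E2 < ENNReal.ofReal 0.706094 := by
  constructor
  · refine (dimH_mono markov_diff_lagrange_subset).trans ?_
    rw [dimH_iUnion]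
    exact iSup_le fun p => dimH_image_lam_deadEnds_le _ _ _
  · calc ENNReal.ofReal 0.174813 + dimH E2
        < ENNReal.ofReal 0.174813 + ENNReal.ofReal 0.531281 :=
          ENNReal.add_lt_add_left ENNReal.ofReal_ne_top dimH_E2_lt
      _ = ENNReal.ofReal 0.706094 := by
          rw [← ENNReal.ofReal_add (by norm_num) (by norm_num)]
          norm_num
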